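/- Let m, n ≥ 2 with gcd(q_m, q_n) = 1, where q_k = (k+1)^k − 1, and let Γ_{m,n} be the presented group ⟨x_m, t_m, x_n, t_n | ρ_m(x_m,t_m), ρ_n(x_n,t_n), x_m^m, x_n^n⟩. Then for every element r of the free group on x_m, t_m, x_n, t_n, the presented group ⟨x_m, t_m, x_n, t_n | ρ_m(x_m,t_m), ρ_n(x_n,t_n), r⟩ is not isomorphic to Γ_{m,n}. -/

import Mathlib

/-- The word `ρ_k(x,t) = (t x t⁻¹) x (t x t⁻¹)⁻¹ x^{-(k+1)}`, evaluated at elements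
`x`, `t` of a group. -/
def rhoWord {G : Type*} [Group G] (k : ℕ) (x t : G) : G :=
  (t * x * t⁻¹) * x * (t * x * t⁻¹)⁻¹ * x ^ (-(k + 1 : ℤ))

/-- `q_k = (k+1)^k - 1`. -/
def q (k : ℕ) : ℕ := (k + 1) ^ k - 1

/-- A group is locally indicable if every nontrivial finitely generated group embedding in it
maps nontrivially to the infinite cyclic group. -/
def LocallyIndicable (G : Type) [Group G] : Prop :=
  ∀ (S : Type) [Group S] [Group.FG S] [Nontrivial S] (i : S →* G), Function.Injective i →
    ∃ φ : S →* Multiplicative ℤ, φ ≠ 1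

namespace LocallyIndicable

open Monoid

variable {G K Q : Type} [Group G] [Group K] [Group Q]

theorem of_injective (hK : LocallyIndicable K) (f : G →* K) (hf : Function.Injective f) :
    LocallyIndicable G := fun S _ _ _ i hi => hK S (f.comp i) (hf.comp hi)

theorem exists_hom_of_hom {S : Type} [Group S] [Group.FG S] (hQ : LocallyIndicable Q)
    {f : S →* Q} (hf : f ≠ 1) : ∃ φ : S →* Multiplicative ℤ, φ ≠ 1 := by
  obtain ⟨s, hs⟩ := DFunLike.ne_iff.1 hf
  have : Nontrivial f.range := ⟨⟨⟨_, s, rfl⟩, 1, fun h => hs (congrArg Subtype.val h)⟩⟩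
  obtain ⟨φ, hφ⟩ := hQ f.range (Subgroup.subtype _) Subtype.val_injective
  refine ⟨φ.comp f.rangeRestrict, fun h => hφ ?_⟩
  ext y
  obtain ⟨x, rfl⟩ := f.rangeRestrict_surjective y
  exact congrArg _ (DFunLike.congr_fun h x)

theorem of_hom (hQ : LocallyIndicable Q) (f : G →* Q) (hf : LocallyIndicable f.ker) :
    LocallyIndicable G := by
  intro S _ _ _ i hi
  by_cases h : ∀ s, f (i s) = 1
  · exact hf S (i.codRestrict f.ker h) fun a b hab => hi (congrArg Subtype.val hab)
  · push Not at h
    obtain ⟨s, hs⟩ := h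
    exact hQ.exists_hom_of_hom (f := f.comp i) fun h => hs (DFunLike.congr_fun h s)

theorem exists_hom_ne_one (hG : LocallyIndicable G) [Nontrivial G] [Group.FG G] :
    ∃ φ : G →* Multiplicative ℤ, φ ≠ 1 := hG G (MonoidHom.id G) Function.injective_id

theorem freeGroup (α : Type) : LocallyIndicable (FreeGroup α) := by
  intro S _ _ _ i hi
  have := IsFreeGroup.ofMulEquiv (i.ofInjective hi).symm
  by_contra! hcon
  obtain ⟨x, hx⟩ := exists_ne (1 : S)
  have h1 := hcon (IsFreeGroup.lift fun _ => Multiplicative.ofAdd 1)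
  have : IsEmpty (IsFreeGroup.Generators S) := by
    refine ⟨fun a => ?_⟩
    have := DFunLike.congr_fun h1 (IsFreeGroup.of a)
    rw [IsFreeGroup.lift_of] at this
    exact one_ne_zero (α := ℤ) (Multiplicative.ofAdd.injective this)
  exact hx (DFunLike.congr_fun
    (IsFreeGroup.ext_hom fun a => isEmptyElim a : MonoidHom.id S = 1) x)

theorem int : LocallyIndicable (Multiplicative ℤ) := by
  intro S _ _ _ i hi
  obtain ⟨x, hx⟩ := exists_ne (1 : S)
  exact ⟨i, fun h => hx (hi (by rw [h]; rfl))⟩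

theorem prod (hG : LocallyIndicable G) (hK : LocallyIndicable K) : LocallyIndicable (G × K) := by
  refine hK.of_hom (MonoidHom.snd G K)
    (hG.of_injective ((MonoidHom.fst G K).comp (Subgroup.subtype _)) ?_)
  rintro ⟨⟨a, b⟩, hb⟩ ⟨⟨c, d⟩, hd⟩ h
  simp only [MonoidHom.mem_ker, MonoidHom.coe_snd] at hb hd
  simp_all

section Coprod

variable (P R : Type) [Group P] [Group R]

/-- The left action of `P` by inverse right multiplication on normal forms of elements of `P ∗ R`,
seen as words in commutators followed by an element of `P × R`. -/
def commAct (F : P × R → FreeGroup (P × R)) :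
    P →* Equiv.Perm (FreeGroup (P × R) × P × R) :=
  MonoidHom.toHomPerm
    { toFun := fun a z => (z.1 * F (z.2.1, z.2.2) * (F (z.2.1 * a⁻¹, z.2.2))⁻¹,
        z.2.1 * a⁻¹, z.2.2)
      map_one' := by
        funext z
        simp [Function.End.one_def]
      map_mul' := fun a b => by
        funext z
        change _ = ((z.1 * F (z.2.1, z.2.2) * (F (z.2.1 * b⁻¹, z.2.2))⁻¹) *
          F (z.2.1 * b⁻¹, z.2.2) * (F (z.2.1 * b⁻¹ * a⁻¹, z.2.2))⁻¹, z.2.1 * b⁻¹ * a⁻¹, z.2.2)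
        simp [mul_assoc] }

/-- The left action of `R` by inverse right multiplication. -/
def rightAct : R →* Equiv.Perm (FreeGroup (P × R) × P × R) :=
  MonoidHom.toHomPerm
    { toFun := fun a z => (z.1, z.2.1, z.2.2 * a⁻¹)
      map_one' := by
        funext z
        simp [Function.End.one_def]
      map_mul' := fun a b => by
        funext z
        change _ = (z.1, z.2.1, z.2.2 * b⁻¹ * a⁻¹)
        simp [mul_assoc] }

/-- The action of `P ∗ R` on normal forms by inverse right multiplication. -/
def coprodAct : Coprod P R →* Equiv.Perm (FreeGroup (P × R) × P × R) :=
  Coprod.lift (commAct P R FreeGroup.of) (rightAct P R)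

/-- Evaluation of a normal form in `P ∗ R`. -/
def commEval (z : FreeGroup (P × R) × P × R) : Coprod P R :=
  FreeGroup.lift (fun c : P × R => (Coprod.inl c.1 * Coprod.inr c.2 * Coprod.inl c.1⁻¹ *
    Coprod.inr c.2⁻¹ : Coprod P R)) z.1 * Coprod.inl z.2.1 * Coprod.inr z.2.2

variable {P R}

theorem coprodAct_inl (a : P) (z : FreeGroup (P × R) × P × R) :
    coprodAct P R (Coprod.inl a) z = (z.1 * FreeGroup.of (z.2.1, z.2.2) *
      (FreeGroup.of (z.2.1 * a⁻¹, z.2.2))⁻¹, z.2.1 * a⁻¹, z.2.2) := rfl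

theorem coprodAct_inr (a : R) (z : FreeGroup (P × R) × P × R) :
    coprodAct P R (Coprod.inr a) z = (z.1, z.2.1, z.2.2 * a⁻¹) := rfl

theorem commEval_coprodAct (g : Coprod P R) :
    ∀ z, commEval P R (coprodAct P R g z) = commEval P R z * g⁻¹ := by
  induction g using Coprod.induction_on with
  | inl a => intro z; simp [coprodAct_inl, commEval, mul_assoc]
  | inr a => intro z; simp [coprodAct_inr, commEval, mul_assoc]
  | mul x y hx hy => intro z; rw [map_mul, Equiv.Perm.mul_apply, hx, hy, mul_inv_rev, mul_assoc]

theorem coprodAct_snd (g : Coprod P R) :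
    ∀ z, (coprodAct P R g z).2 = z.2 * (Coprod.toProd g)⁻¹ := by
  induction g using Coprod.induction_on with
  | inl a => intro z; simp [coprodAct_inl, Prod.ext_iff]
  | inr a => intro z; simp [coprodAct_inr, Prod.ext_iff]
  | mul x y hx hy =>
    intro z; rw [map_mul, Equiv.Perm.mul_apply, hx, hy, map_mul, mul_inv_rev, mul_assoc]

theorem coprodAct_fst (g : Coprod P R) :
    ∀ u z, (coprodAct P R g (u * z.1, z.2)).1 = u * (coprodAct P R g z).1 := by
  induction g using Coprod.induction_on with
  | inl a => intro u z; simp [coprodAct_inl, mul_assoc]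
  | inr a => intro u z; simp [coprodAct_inr]
  | mul x y hx hy =>
    intro u z
    have h1 : coprodAct P R y (u * z.1, z.2) =
        (u * (coprodAct P R y z).1, (coprodAct P R y z).2) :=
      Prod.ext (hy u z) (by rw [coprodAct_snd, coprodAct_snd])
    rw [map_mul, Equiv.Perm.mul_apply, h1, hx, Equiv.Perm.mul_apply]

theorem coprod (hP : LocallyIndicable P) (hR : LocallyIndicable R) :
    LocallyIndicable (Coprod P R) := by
  refine (hP.prod hR).of_hom Coprod.toProd ?_
  have key : ∀ g : (Coprod.toProd : Coprod P R →* P × R).ker, ∀ u : FreeGroup (P × R),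
      coprodAct P R g (u, 1) = (u * (coprodAct P R g 1).1, 1) := by
    intro g u
    have hg : Coprod.toProd (g : Coprod P R) = 1 := g.2
    refine Prod.ext ?_ ?_
    · simpa using coprodAct_fst (g : Coprod P R) u 1
    · rw [coprodAct_snd, hg]
      simp
  let κ : (Coprod.toProd : Coprod P R →* P × R).ker →* FreeGroup (P × R) :=
    { toFun := fun g => (coprodAct P R g 1).1⁻¹
      map_one' := by simp
      map_mul' := fun a b => by
        have h1 := key b 1
        have h2 := key a (coprodAct P R b 1).1
        rw [one_mul] at h1
        rw [Subgroup.coe_mul, map_mul, Equiv.Perm.mul_apply, ← mul_inv_rev]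
        change (coprodAct P R a (coprodAct P R b (1, 1))).1⁻¹ = _
        rw [h1, h2] }
  refine (freeGroup _).of_injective κ ((injective_iff_map_eq_one κ).2 fun g hg => ?_)
  have h1 : (coprodAct P R g 1).1 = 1 := inv_eq_one.1 hg
  have h2 := key g 1
  rw [h1, one_mul] at h2
  have h3 := commEval_coprodAct (g : Coprod P R) (1, 1)
  rw [h2] at h3
  exact Subtype.ext (inv_eq_one.1 (mul_eq_left.1 h3.symm))

end Coprod

end LocallyIndicable

section

open HNNExtension HNNExtension.NormalWord

section WordEval

variable {H X Y : Type} [Group H] [Group X] [Group Y]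

/-- The value of the product of the `t ^ ε * h` over the list of pairs `(ε, h)`, for the
interpretations `f` of the coefficients and `τ` of the letter `t`. -/
def wordEval (f : H →* X) (τ : X) (L : List (ℤˣ × H)) : X :=
  (L.map fun p => τ ^ (p.1 : ℤ) * f p.2).prod

@[simp]
theorem wordEval_nil (f : H →* X) (τ : X) : wordEval f τ [] = 1 := rfl

@[simp]
theorem wordEval_cons (f : H →* X) (τ : X) (p : ℤˣ × H) (L : List (ℤˣ × H)) :
    wordEval f τ (p :: L) = τ ^ (p.1 : ℤ) * f p.2 * wordEval f τ L := by simp [wordEval]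

@[simp]
theorem wordEval_append (f : H →* X) (τ : X) (L M : List (ℤˣ × H)) :
    wordEval f τ (L ++ M) = wordEval f τ L * wordEval f τ M := by simp [wordEval]

theorem map_wordEval (g : X →* Y) (f : H →* X) (τ : X) (L : List (ℤˣ × H)) :
    g (wordEval f τ L) = wordEval (g.comp f) (g τ) L := by
  simp [wordEval, map_list_prod, Function.comp_def]

theorem isConj_wordEval_append (f : H →* X) (τ : X) (L M : List (ℤˣ × H)) :
    IsConj (wordEval f τ (L ++ M)) (wordEval f τ (M ++ L)) :=
  isConj_iff.2 ⟨(wordEval f τ L)⁻¹, by simp⟩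

end WordEval

/-- A list that is not a cyclic chain can be rotated so that it starts with a violation. -/
theorem List.exists_rotation {α : Type} (R : α → α → Prop) (L : List α) :
    (L ++ L).IsChain R ∨ (∃ a, L = [a] ∧ ¬ R a a) ∨
      ∃ A B a b C, L = A ++ B ∧ B ++ A = a :: b :: C ∧ ¬ R a b := by
  by_cases h : L.IsChain R
  · by_cases h' : ∀ x ∈ L.getLast?, ∀ y ∈ L.head?, R x y
    · exact Or.inl (List.isChain_append.2 ⟨h, h, h'⟩)
    · push Not at h'
      obtain ⟨x, hx, y, hy, hxy⟩ := h'
      obtain ⟨M, rfl⟩ := List.mem_getLast?_eq_getLast hx |> fun ⟨h1, h2⟩ =>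
        (⟨L.dropLast, by rw [h2, List.dropLast_append_getLast]⟩ : ∃ M, L = M ++ [x])
      cases M with
      | nil =>
        obtain rfl : x = y := by simpa using hy
        exact Or.inr (Or.inl ⟨x, rfl, hxy⟩)
      | cons z M =>
        obtain rfl : z = y := by simpa using hy
        exact Or.inr (Or.inr ⟨z :: M, [x], x, z, M, rfl, rfl, hxy⟩)
  · have : ∃ A a b C, L = A ++ a :: b :: C ∧ ¬ R a b := by
      induction L with
      | nil => exact absurd List.isChain_nil h
      | cons a L ih =>
        cases L with
        | nil => exact absurd (List.isChain_singleton a) h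
        | cons b L =>
          by_cases hab : R a b
          · obtain ⟨A, x, y, C, hL, hxy⟩ := ih fun h' => h (List.isChain_cons_cons.2 ⟨hab, h'⟩)
            exact ⟨a :: A, x, y, C, by rw [hL, List.cons_append], hxy⟩
          · exact ⟨[], a, b, L, rfl, hab⟩
    obtain ⟨A, a, b, C, rfl, hab⟩ := this
    exact Or.inr (Or.inr ⟨A, a :: b :: C, a, b, C ++ A, rfl, rfl, hab⟩)

theorem List.isChain_flatten_replicate {α : Type} {R : α → α → Prop} {L : List α}
    (h : (L ++ L).IsChain R) (j : ℕ) : (List.replicate j L).flatten.IsChain R := by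
  obtain ⟨h1, -, h2⟩ := List.isChain_append.1 h
  induction j with
  | zero => exact List.isChain_nil
  | succ j ih =>
    rw [List.replicate_succ, List.flatten_cons]
    refine List.isChain_append.2 ⟨h1, ih, fun x hx y hy => h2 x hx y ?_⟩
    cases j with
    | zero => simp at hy
    | succ j =>
      rw [List.replicate_succ, List.flatten_cons] at hy
      cases L with
      | nil => simp at hx
      | cons a L => simpa using hy

namespace HNNExtension

variable {G : Type} [Group G] {A B : Subgroup G} {φ : A ≃* B}

/-- Two successive letters of a word in an HNN extension admit no cancellation. -/
def Reduced (A B : Subgroup G) (a b : ℤˣ × G) : Prop := a.2 ∈ toSubgroup A B a.1 → a.1 = b.1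

section Length

variable (d : TransversalPair G A B)

/-- The number of occurrences of the stable letter in the normal form of an element. -/
noncomputable def tLength (g : HNNExtension G A B φ) : ℕ :=
  (g • (empty : NormalWord d)).toList.length

theorem length_toList_t_zpow_smul_le (u : ℤˣ) (w : NormalWord d) :
    ((t ^ (u : ℤ) : HNNExtension G A B φ) • w).toList.length ≤ w.toList.length + 1 := by
  rw [t_pow_smul_eq_unitsSMul, unitsSMul]
  split_ifs with h
  · cases w using consRecOn with
    | ofGroup => simp [Cancels] at h
    | cons g u w h1 h2 =>
      simp only [unitsSMulWithCancel, consRecOn_cons, group_smul_toList, cons_toList,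
        List.length_cons]
      lia
  · simp

theorem length_toList_wordEval_smul_le (L : List (ℤˣ × G)) (w : NormalWord d) :
    ((wordEval of t L : HNNExtension G A B φ) • w).toList.length ≤
      L.length + w.toList.length := by
  induction L with
  | nil => simp
  | cons p L ih =>
    rw [wordEval_cons, mul_assoc, mul_smul, mul_smul]
    refine (length_toList_t_zpow_smul_le d _ _).trans ?_
    rw [of_smul_eq_smul, group_smul_toList, List.length_cons]
    lia

theorem exists_eq_of_mul_wordEval (g : HNNExtension G A B φ) :
    ∃ h L, L.length = tLength d g ∧ g = of h * wordEval of t L :=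
  ⟨_, _, rfl, by
    have := prod_smul (d := d) φ g empty
    rw [prod_empty, mul_one] at this
    exact this.symm⟩

theorem tLength_mul_le (g h : HNNExtension G A B φ) :
    tLength d (g * h) ≤ tLength d g + tLength d h := by
  obtain ⟨a, L, hL, hg⟩ := exists_eq_of_mul_wordEval d g
  rw [← hL, hg, mul_assoc, tLength, mul_smul, mul_smul, of_smul_eq_smul, group_smul_toList]
  exact length_toList_wordEval_smul_le d _ _

theorem tLength_of (g : G) : tLength d (of g : HNNExtension G A B φ) = 0 := by
  rw [tLength, of_smul_eq_smul]
  rfl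

theorem tLength_wordEval {L : List (ℤˣ × G)} (hL : L.IsChain (Reduced A B)) :
    tLength d (wordEval of t L : HNNExtension G A B φ) = L.length := by
  obtain ⟨w, hw, hw', -⟩ := ReducedWord.exists_normalWord_prod_eq φ d ⟨1, L, hL⟩
  have h1 : ReducedWord.prod φ ⟨1, L, hL⟩ = wordEval of t L := by
    simp [ReducedWord.prod, wordEval]
  rw [← h1, ← hw, tLength, prod_smul_empty, ← List.length_map, hw', List.length_map]

theorem le_tLength_wordEval_pow {L : List (ℤˣ × G)} (hL : (L ++ L).IsChain (Reduced A B))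
    (hne : L ≠ []) (j : ℕ) : j ≤ tLength d ((wordEval of t L : HNNExtension G A B φ) ^ j) := by
  have h : ∀ j : ℕ, (wordEval of t L : HNNExtension G A B φ) ^ j =
      wordEval of t (List.replicate j L).flatten := by
    intro j
    induction j with
    | zero => simp
    | succ j ih => rw [pow_succ', ih, List.replicate_succ, List.flatten_cons, wordEval_append]
  rw [h, tLength_wordEval d (List.isChain_flatten_replicate hL j)]
  have := List.length_pos_iff.2 hne
  simp only [List.length_flatten, List.map_replicate, List.sum_replicate, smul_eq_mul]
  exact Nat.le_mul_of_pos_right j this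

end Length

theorem not_isConj_of {L : List (ℤˣ × G)} (hL : (L ++ L).IsChain (Reduced A B))
    (hne : L ≠ []) (g : G) : ¬ IsConj (wordEval of t L : HNNExtension G A B φ) (of g) := by
  intro h
  obtain ⟨d⟩ := TransversalPair.nonempty G A B
  obtain ⟨c, hc⟩ := isConj_iff.1 h.symm
  have h1 := le_tLength_wordEval_pow (φ := φ) d hL hne (tLength d c + tLength d c⁻¹ + 1)
  rw [← hc, conj_pow, ← map_pow] at h1
  have h2 := tLength_mul_le d (c * of (g ^ (tLength d c + tLength d c⁻¹ + 1))) c⁻¹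
  have h3 := tLength_mul_le d c (of (g ^ (tLength d c + tLength d c⁻¹ + 1)))
  rw [tLength_of] at h3
  lia

theorem conj_ne_pow {L : List (ℤˣ × G)} (hL : (L ++ L).IsChain (Reduced A B))
    (hne : L ≠ []) {q : ℕ} (hq : 2 ≤ q) {x a : HNNExtension G A B φ}
    (hx : IsConj (wordEval of t L) x) : a * x * a⁻¹ ≠ x ^ q := by
  intro h
  obtain ⟨d⟩ := TransversalPair.nonempty G A B
  obtain ⟨c, hc⟩ := isConj_iff.1 hx.symm
  have h1 : ∀ i : ℕ, x ^ q ^ i = a ^ i * x * (a⁻¹) ^ i := by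
    intro i
    induction i with
    | zero => simp
    | succ i ih =>
      rw [pow_succ' q, pow_mul, ← h, conj_pow, ih, pow_succ' a, pow_succ]
      simp only [mul_assoc]
  have hpow : ∀ (b : HNNExtension G A B φ) (i : ℕ), tLength d (b ^ i) ≤ i * tLength d b := by
    intro b i
    induction i with
    | zero =>
      rw [pow_zero, ← map_one (of : G →* HNNExtension G A B φ), tLength_of]
      simp
    | succ i ih =>
      have := tLength_mul_le d (b ^ i) b
      rw [pow_succ]
      lia
  have h2 : ∀ i : ℕ, q ^ i ≤ i * (tLength d a + tLength d a⁻¹) +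
      (tLength d x + tLength d c + tLength d c⁻¹) := by
    intro i
    have e1 := le_tLength_wordEval_pow (φ := φ) d hL hne (q ^ i)
    rw [← hc, conj_pow, h1] at e1
    have e2 := tLength_mul_le d (c * (a ^ i * x * (a⁻¹) ^ i)) c⁻¹
    have e3 := tLength_mul_le d c (a ^ i * x * (a⁻¹) ^ i)
    have e4 := tLength_mul_le d (a ^ i * x) ((a⁻¹) ^ i)
    have e5 := tLength_mul_le d (a ^ i) x
    have e6 := hpow a i
    have e7 := hpow a⁻¹ i
    lia
  generalize tLength d a + tLength d a⁻¹ = C at h2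
  generalize tLength d x + tLength d c + tLength d c⁻¹ = D at h2
  have h3 : ∀ i : ℕ, 2 ^ i ≤ i * (C + D + 1) + (C + D + 1) := fun i =>
    ((Nat.pow_le_pow_left hq i).trans (h2 i)).trans (by gcongr <;> lia)
  generalize C + D + 1 = E at h3
  have h4 := h3 (2 * E + 4)
  have h5 : 4 * (E + 1) ≤ 2 ^ (E + 2) := by
    rw [pow_add, mul_comm]
    exact Nat.mul_le_mul_right 4 Nat.lt_two_pow_self
  have h6 : 2 ^ (2 * E + 4) = 2 ^ (E + 2) * 2 ^ (E + 2) := by rw [← pow_add]; congr 1; lia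
  nlinarith

theorem isConj_of_or_wordEval (h : G) (L : List (ℤˣ × G)) :
    (∃ g, IsConj (of h * wordEval of t L : HNNExtension G A B φ) (of g)) ∨
      ∃ M, M ≠ [] ∧ M.length = L.length ∧
        IsConj (of h * wordEval of t L : HNNExtension G A B φ) (wordEval of t M) := by
  rcases L.eq_nil_or_concat with rfl | ⟨L, p, rfl⟩
  · exact Or.inl ⟨h, by rw [wordEval_nil, mul_one]⟩
  · refine Or.inr ⟨L ++ [(p.1, p.2 * h)], by simp, by simp, isConj_iff.2 ⟨(of h)⁻¹, ?_⟩⟩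
    simp [mul_assoc]

theorem exists_isConj (x : HNNExtension G A B φ) :
    (∃ g, IsConj x (of g)) ∨ ∃ L, L ≠ [] ∧ (L ++ L).IsChain (Reduced A B) ∧
      IsConj x (wordEval of t L) := by
  obtain ⟨d⟩ := TransversalPair.nonempty G A B
  obtain ⟨h, L, -, rfl⟩ := exists_eq_of_mul_wordEval d x
  generalize hn : L.length = n
  induction n using Nat.strong_induction_on generalizing h L with
  | _ n ih =>
    rcases isConj_of_or_wordEval (φ := φ) h L with h1 | ⟨M, hM, hlen, h1⟩
    · exact Or.inl h1
    rcases List.exists_rotation (Reduced A B) M with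
      h2 | ⟨a, rfl, h2⟩ | ⟨P, Q, a, b, C, rfl, h2, h3⟩
    · exact Or.inr ⟨M, hM, h2, h1⟩
    · exact absurd (fun _ => rfl) h2
    · simp only [Reduced, Classical.not_imp] at h3
      have hb : b.1 = -a.1 := by
        rw [← Int.units_ne_iff_eq_neg]
        exact fun h => h3.2 h.symm
      have h4 := h1.trans (isConj_wordEval_append _ _ P Q)
      have h5 : ∃ g, (wordEval of t (Q ++ P) : HNNExtension G A B φ) = of g * wordEval of t C := by
        rw [h2, wordEval_cons, wordEval_cons, hb]
        obtain ⟨u, a⟩ := a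
        rcases Int.units_eq_one_or u with rfl | rfl
        · refine ⟨φ ⟨a, h3.1⟩ * b.2, ?_⟩
          rw [map_mul, equiv_eq_conj]
          simp [mul_assoc]
        · refine ⟨φ.symm ⟨a, h3.1⟩ * b.2, ?_⟩
          rw [map_mul, equiv_symm_eq_conj]
          simp [mul_assoc]
      obtain ⟨g, hg⟩ := h5
      have hlen2 : C.length < n := by
        have := congrArg List.length h2
        simp only [List.length_append, List.length_cons] at this hlen
        lia
      rw [hg] at h4
      rcases ih _ hlen2 g C rfl with ⟨k, hk⟩ | ⟨L', h6, h7, h8⟩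
      · exact Or.inl ⟨k, h4.trans hk⟩
      · exact Or.inr ⟨L', h6, h7, h4.trans h8⟩

end HNNExtension

end

section

open HNNExtension Monoid

section Embeddings

variable {K H X : Type} [Group K] [Group H] [Group X]

theorem exists_conj_extension (i₁ i₂ : K →* X) (h₁ : Function.Injective i₁)
    (h₂ : Function.Injective i₂) :
    ∃ (Y : Type) (_ : Group Y) (j : X →* Y) (y : Y) (χ : Y →* Multiplicative ℤ),
      Function.Injective j ∧ (∀ k, y * j (i₁ k) * y⁻¹ = j (i₂ k)) ∧
        χ y = Multiplicative.ofAdd 1 ∧ ∀ x, χ (j x) = 1 := by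
  let φ : i₁.range ≃* i₂.range := (i₁.ofInjective h₁).symm.trans (i₂.ofInjective h₂)
  refine ⟨HNNExtension X i₁.range i₂.range φ, inferInstance, of, t,
    lift 1 (Multiplicative.ofAdd 1) (by simp), of_injective φ, fun k => ?_, lift_t _ _ _,
    fun x => ?_⟩
  · have h : φ ⟨i₁ k, k, rfl⟩ = ⟨i₂ k, k, rfl⟩ := by
      have : (⟨i₁ k, k, rfl⟩ : i₁.range) = i₁.ofInjective h₁ k := rfl
      rw [this, MulEquiv.trans_apply, MulEquiv.symm_apply_apply]
      rfl
    exact (equiv_eq_conj (φ := φ) ⟨i₁ k, k, rfl⟩).symm.trans (by rw [h])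
  · rw [lift_of]
    rfl

theorem exists_amalgam (i : K →* H) (u : K →* X) (hi : Function.Injective i)
    (hu : Function.Injective u) :
    ∃ (Y : Type) (_ : Group Y) (a : H →* Y) (b : X →* Y),
      Function.Injective a ∧ Function.Injective b ∧ ∀ k, a (i k) = b (u k) := by
  obtain ⟨Y, _, j, y, -, hj, hy, -⟩ := exists_conj_extension
    ((Coprod.inl : H →* Coprod H X).comp i) (Coprod.inr.comp u)
    (Coprod.inl_injective.comp hi) (Coprod.inr_injective.comp hu)
  exact ⟨Y, _, (MulAut.conj y).toMonoidHom.comp (j.comp Coprod.inl), j.comp Coprod.inr,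
    (MulAut.conj y).injective.comp (hj.comp Coprod.inl_injective),
    hj.comp Coprod.inr_injective, hy⟩

end Embeddings

/-- The free product of `H` with an infinite cyclic group generated by `t`. -/
abbrev EqGroup (H : Type) [Group H] : Type := HNNExtension H ⊥ ⊥ (MulEquiv.refl (⊥ : Subgroup H))

namespace EqGroup

variable {H K X Y : Type} [Group H] [Group K] [Group X] [Group Y]

/-- Evaluation of the elements of `EqGroup H` at `τ`. -/
def lift (f : H →* X) (τ : X) : EqGroup H →* X :=
  HNNExtension.lift f τ (by rintro ⟨a, rfl⟩; simp)

@[simp]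
theorem lift_of (f : H →* X) (τ : X) (h : H) : lift f τ (of h) = f h := HNNExtension.lift_of _ _ _ _

@[simp]
theorem lift_t (f : H →* X) (τ : X) : lift f τ t = τ := HNNExtension.lift_t _ _ _

@[simp]
theorem lift_comp_of (f : H →* X) (τ : X) : (lift f τ).comp of = f := MonoidHom.ext (lift_of f τ)

theorem hom_ext {f g : EqGroup H →* X} (h : ∀ a, f (of a) = g (of a)) (ht : f t = g t) : f = g :=
  HNNExtension.hom_ext (MonoidHom.ext h) ht

theorem lift_wordEval (f : H →* X) (τ : X) (L : List (ℤˣ × H)) :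
    lift f τ (wordEval of t L) = wordEval f τ L := by
  rw [map_wordEval, lift_t, lift_comp_of]

theorem isChain_reduced {L : List (ℤˣ × H)} (hL : ∀ p ∈ L, p.2 ≠ 1) :
    L.IsChain (Reduced (⊥ : Subgroup H) ⊥) := by
  induction L with
  | nil => exact List.isChain_nil
  | cons p L ih =>
    refine List.isChain_cons.2 ⟨fun y _ hp => ?_, ih fun q hq => hL q (List.mem_cons_of_mem _ hq)⟩
    have : HNNExtension.toSubgroup (⊥ : Subgroup H) ⊥ p.1 = ⊥ := ite_self _
    rw [this] at hp
    exact absurd hp (hL p List.mem_cons_self)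

theorem isChain_reduced_append_self {L : List (ℤˣ × H)} (hL : ∀ p ∈ L, p.2 ≠ 1) :
    (L ++ L).IsChain (Reduced (⊥ : Subgroup H) ⊥) :=
  isChain_reduced (by simpa using hL)

/-- `g` can be written with at most `N` occurrences of the letter `t`. -/
def LengthLE (N : ℕ) (g : EqGroup H) : Prop :=
  ∃ h L, L.length ≤ N ∧ g = of h * wordEval of t L

theorem LengthLE.of (h : H) (N : ℕ) : LengthLE N (of h : EqGroup H) := ⟨h, [], by simp, by simp⟩

theorem LengthLE.one (N : ℕ) : LengthLE N (1 : EqGroup H) := by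
  rw [← map_one HNNExtension.of]
  exact .of 1 N

theorem LengthLE.t_zpow (u : ℤˣ) : LengthLE 1 (t ^ (u : ℤ) : EqGroup H) :=
  ⟨1, [(u, 1)], by simp, by simp⟩

theorem LengthLE.mul {N M : ℕ} {g h : EqGroup H} (hg : LengthLE N g) (hh : LengthLE M h) :
    LengthLE (N + M) (g * h) := by
  obtain ⟨a, L, hL, rfl⟩ := hg
  obtain ⟨b, L', hL', rfl⟩ := hh
  rcases L.eq_nil_or_concat with rfl | ⟨L, p, rfl⟩
  · exact ⟨a * b, L', by lia, by simp [mul_assoc]⟩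
  · refine ⟨a, L ++ (p.1, p.2 * b) :: L', ?_, by simp [mul_assoc]⟩
    simp only [List.length_concat, List.length_append, List.length_cons] at hL ⊢
    lia

/-- The equation `g = 1` is solvable in some overgroup of the coefficient group. -/
def HasSolution (g : EqGroup H) : Prop :=
  ∃ (X : Type) (_ : Group X) (f : H →* X) (τ : X), Function.Injective f ∧ lift f τ g = 1

/-- Either `g` is conjugate to a coefficient, or `g = 1` is solvable over the coefficients. -/
def Dichotomy (g : EqGroup H) : Prop := (∃ h, IsConj g (of h)) ∨ HasSolution g

theorem Dichotomy.of_isConj {g g' : EqGroup H} (h : IsConj g g') (hg : Dichotomy g') :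
    Dichotomy g := by
  refine hg.imp (fun ⟨a, ha⟩ => ⟨a, h.trans ha⟩) fun ⟨X, _, f, τ, hf, hX⟩ => ⟨X, _, f, τ, hf, ?_⟩
  have := (lift f τ).map_isConj h
  rwa [hX, isConj_one_left] at this

theorem Dichotomy.map_of_injective (i : K →* H) (hi : Function.Injective i) {g : EqGroup K}
    (hg : Dichotomy g) : Dichotomy (lift (of.comp i) t g : EqGroup H) := by
  refine hg.imp (fun ⟨a, ha⟩ => ⟨i a, ?_⟩) fun ⟨X, _, f, τ, hf, hX⟩ => ?_
  · simpa using (lift ((of : H →* EqGroup H).comp i) t).map_isConj ha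
  · obtain ⟨Y, _, a, b, ha, hb, hab⟩ := exists_amalgam i f hi hf
    refine ⟨Y, _, a, b τ, ha, ?_⟩
    have : (lift a (b τ)).comp (lift ((of : H →* EqGroup H).comp i) t) = b.comp (lift f τ) :=
      hom_ext (by simpa using hab) (by simp)
    have := DFunLike.congr_fun this g
    simpa [hX] using this

/-- The dichotomy for all equations with at most `N` occurrences of the unknown. -/
def DichotomyLE (N : ℕ) : Prop :=
  ∀ (H : Type) [Group H], LocallyIndicable H → ∀ g : EqGroup H, LengthLE N g → Dichotomy g

end EqGroup

section Levels

variable {H X Y : Type} [Group H] [Group X] [Group Y] (d : ℤ) (η : H →* Multiplicative ℤ)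

/-- The level of the letter `t` in `t ^ ε * h`, read at height `c`, when `t` has height `d`. -/
def letterLevel (c : ℤ) (p : ℤˣ × H) : ℤ := if p.1 = 1 then c else c - d

/-- The height of `t ^ ε * h`, for the height `d` of `t` and the heights `η` of coefficients. -/
def height (p : ℤˣ × H) : ℤ := p.1 * d + (η p.2).toAdd

/-- The levels of the letters `t` in a word read from height `c`. -/
def levels (c : ℤ) : List (ℤˣ × H) → List ℤ
  | [] => []
  | p :: L => letterLevel d c p :: levels (c + height d η p) L

/-- The value of a word in which the letter `t` at level `i` is interpreted as `s i`. -/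
def levelEval (f : H →* X) (s : ℤ → X) (c : ℤ) : List (ℤˣ × H) → X
  | [] => 1
  | p :: L => s (letterLevel d c p) ^ (p.1 : ℤ) * f p.2 * levelEval f s (c + height d η p) L

@[simp]
theorem length_levels (c : ℤ) (L : List (ℤˣ × H)) : (levels d η c L).length = L.length := by
  induction L generalizing c with
  | nil => rfl
  | cons p L ih => simp [levels, ih]

theorem levelEval_const (f : H →* X) (τ : X) (c : ℤ) (L : List (ℤˣ × H)) :
    levelEval d η f (fun _ => τ) c L = wordEval f τ L := by
  induction L generalizing c with
  | nil => rfl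
  | cons p L ih => simp [levelEval, ih]

theorem map_levelEval (g : X →* Y) (f : H →* X) (s : ℤ → X) (c : ℤ) (L : List (ℤˣ × H)) :
    g (levelEval d η f s c L) = levelEval d η (g.comp f) (fun i => g (s i)) c L := by
  induction L generalizing c with
  | nil => exact map_one g
  | cons p L ih => simp [levelEval, ih]

theorem levelEval_congr (f : H →* X) {s s' : ℤ → X} {c : ℤ} {L : List (ℤˣ × H)}
    (h : ∀ i ∈ levels d η c L, s i = s' i) : levelEval d η f s c L = levelEval d η f s' c L := by
  induction L generalizing c with
  | nil => rfl
  | cons p L ih =>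
    simp only [levels, List.mem_cons, forall_eq_or_imp] at h
    rw [levelEval, levelEval, h.1, ih h.2]

theorem lengthLE_levelEval (f : H →* X) (s : ℤ → EqGroup X) (w : ℤ → ℕ)
    (hs : ∀ i (u : ℤˣ), EqGroup.LengthLE (w i) (s i ^ (u : ℤ))) (c : ℤ) (L : List (ℤˣ × H)) :
    EqGroup.LengthLE ((levels d η c L).map w).sum
      (levelEval d η ((of : X →* EqGroup X).comp f) s c L) := by
  induction L generalizing c with
  | nil => exact .one _
  | cons p L ih =>
    exact ((hs _ _).mul (.of _ 0)).mul (ih _)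

theorem zpow_mul_wordEval (f : H →* X) (y s : X) (hy : ∀ h, Commute y (f h)) (f' : H →* X)
    (hf' : ∀ h, f' h = f h * y ^ (η h).toAdd) (c : ℤ) (L : List (ℤˣ × H)) :
    y ^ c * wordEval f' (s * y ^ d) L =
      levelEval d η f (fun i => y ^ i * s * y ^ (-i)) c L *
        y ^ (c + (L.map (height d η)).sum) := by
  induction L generalizing c with
  | nil => simp [levelEval]
  | cons p L ih =>
    obtain ⟨u, h⟩ := p
    have hc : ∀ (n : ℤ) (z : X), y ^ n * (f h * z) = f h * (y ^ n * z) := fun n z => by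
      rw [← mul_assoc, ((hy h).zpow_left n).eq, mul_assoc]
    have hn : ∀ (a b : ℤ) (z : X), y ^ a * (y ^ b * z) = y ^ (a + b) * z := fun a b z => by
      rw [← mul_assoc, zpow_add]
    have key : y ^ c * ((s * y ^ d) ^ (u : ℤ) * f' h) =
        (y ^ letterLevel d c (u, h) * s * y ^ (-letterLevel d c (u, h))) ^ (u : ℤ) * f h *
          y ^ (c + height d η (u, h)) := by
      rw [hf']
      rcases Int.units_eq_one_or u with rfl | rfl
      · simp only [letterLevel, height, if_true, Units.val_one, zpow_one, one_mul, mul_assoc, hc]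
        rw [← zpow_add, ← zpow_add]
        congr 4
        ring
      · have : (-1 : ℤˣ) ≠ 1 := by decide
        simp only [letterLevel, height, if_neg this, Units.val_neg, Units.val_one, zpow_neg_one,
          mul_inv_rev, mul_assoc]
        simp only [← zpow_neg]
        simp only [hc, hn, ← zpow_add]
        congr 5 <;> ring
    rw [wordEval_cons, levelEval, List.map_cons, List.sum_cons, ← add_assoc, mul_assoc _ _ (y ^ _),
      ← ih]
    simpa only [mul_assoc] using congrArg (· * wordEval f' (s * y ^ d) L) key

end Levels

section Assemble

variable {H X : Type} [Group H] [Group X]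

/-- The group `H ∗ F_n`. -/
abbrev CoprodFree (H : Type) [Group H] (n : ℕ) : Type := Coprod H (FreeGroup (Fin n))

/-- The homomorphism from `H ∗ F_n` given by a homomorphism on `H` and the images of the free
generators. -/
def evalFree {n : ℕ} (f : H →* X) (s : Fin n → X) : CoprodFree H n →* X :=
  Coprod.lift f (FreeGroup.lift s)

/-- The free generators of `H ∗ F_n`. -/
def freeLetter (H : Type) [Group H] {n : ℕ} (i : Fin n) : CoprodFree H n :=
  Coprod.inr (FreeGroup.of i)

@[simp]
theorem evalFree_inl {n : ℕ} (f : H →* X) (s : Fin n → X) (h : H) :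
    evalFree f s (Coprod.inl h) = f h := rfl

@[simp]
theorem evalFree_freeLetter {n : ℕ} (f : H →* X) (s : Fin n → X) (i : Fin n) :
    evalFree f s (freeLetter H i) = s i := by simp [evalFree, freeLetter]

theorem coprodFree_hom_ext {n : ℕ} {f g : CoprodFree H n →* X}
    (h : ∀ a, f (Coprod.inl a) = g (Coprod.inl a))
    (h' : ∀ i, f (freeLetter H i) = g (freeLetter H i)) : f = g :=
  Coprod.hom_ext (MonoidHom.ext h) (FreeGroup.ext_hom _ _ h')

/-- The equation `v = 1` is solvable for the generator `i` in an overgroup of `H ∗ F_n`, where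
`F_n` is generated by the other generators. -/
def SolvableAt {n : ℕ} (i : Fin (n + 1)) (v : CoprodFree H (n + 1)) : Prop :=
  ∃ (X : Type) (_ : Group X) (f : H →* X) (s : Fin (n + 1) → X),
    Function.Injective (evalFree f fun j => s (i.succAbove j)) ∧ evalFree f s v = 1

theorem exists_shift_of_solvableAt {n : ℕ} {v : CoprodFree H (n + 1)} (h₀ : SolvableAt 0 v)
    (h₁ : SolvableAt (Fin.last n) v) :
    ∃ (Y : Type) (_ : Group Y) (f : H →* Y) (s y : Y) (χ : Y →* Multiplicative ℤ),
      Function.Injective f ∧ (∀ h, Commute y (f h)) ∧ χ y = Multiplicative.ofAdd 1 ∧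
        (∀ h, χ (f h) = 1) ∧
        evalFree f (fun i : Fin (n + 1) => y ^ (i : ℤ) * s * y ^ (-(i : ℤ))) v = 1 := by
  obtain ⟨X₁, _, f₁, s₁, hi₁, hv₁⟩ := h₀
  obtain ⟨X₂, _, f₂, s₂, hi₂, hv₂⟩ := h₁
  have hfst : ∀ (m : ℕ) (s : Fin m → X₁) (s' : Fin m → X₂),
      evalFree (f₁.prod f₂) (fun i => (s i, s' i)) = (evalFree f₁ s).prod (evalFree f₂ s') :=
    fun m s s' => coprodFree_hom_ext (fun a => rfl) fun i => by simp
  let s : Fin (n + 1) → X₁ × X₂ := fun i => (s₁ i, s₂ i)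
  have hin : Function.Injective (evalFree (f₁.prod f₂) fun i => s (Fin.last n |>.succAbove i)) := by
    rw [hfst]
    exact fun a b hab => hi₂ (congrArg Prod.snd hab)
  have hin' : Function.Injective (evalFree (f₁.prod f₂) fun i => s (Fin.succAbove 0 i)) := by
    rw [hfst]
    exact fun a b hab => hi₁ (congrArg Prod.fst hab)
  obtain ⟨Y, _, j, y, χ, hj, hy, hχy, hχ⟩ := exists_conj_extension _ _ hin hin'
  have hs : ∀ i : Fin n, j (s i.succ) = y * j (s i.castSucc) * y⁻¹ := fun i => by
    have := hy (freeLetter H i)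
    simp only [evalFree_freeLetter, Fin.succAbove_last, Fin.zero_succAbove] at this
    exact this.symm
  have hs' : ∀ i : Fin (n + 1), j (s i) = y ^ (i : ℤ) * j (s 0) * y ^ (-(i : ℤ)) := fun i => by
    induction i using Fin.induction with
    | zero => simp
    | succ i ih =>
      rw [hs, ih, Fin.val_succ, Fin.val_castSucc]
      push_cast
      rw [neg_add, zpow_add, zpow_add, zpow_neg_one, zpow_one,
        ((Commute.refl y).zpow_left (i : ℤ)).eq]
      simp only [mul_assoc]
  refine ⟨Y, _, j.comp (f₁.prod f₂), j (s 0), y, χ, ?_, fun h => ?_, hχy, fun h => hχ _, ?_⟩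
  · exact hj.comp fun a b hab => Coprod.inl_injective (hin hab)
  · exact mul_inv_eq_iff_eq_mul.1 (hy (Coprod.inl h))
  · have : evalFree (j.comp (f₁.prod f₂)) (fun i => j (s i)) =
        j.comp ((evalFree f₁ s₁).prod (evalFree f₂ s₂)) := by
      rw [← hfst]
      exact coprodFree_hom_ext (fun a => rfl) fun i => by simp [s]
    simp_rw [← hs', this]
    simp only [MonoidHom.comp_apply, MonoidHom.prod_apply, hv₁, hv₂]
    exact map_one j

end Assemble

theorem List.sum_map_lt_length {α : Type*} {l : List α} {w : α → ℕ} (h : ∀ i ∈ l, w i ≤ 1)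
    (h' : ∃ i ∈ l, w i = 0) : (l.map w).sum < l.length := by
  obtain ⟨i, hi, h'⟩ := h'
  have := List.sum_lt_sum w (fun _ => 1) h ⟨i, hi, by lia⟩
  simpa using this

namespace EqGroup

variable {H : Type} [Group H] (d : ℤ) (η : H →* Multiplicative ℤ)

/-- The lift of a word in `t` and `H` to the free product of `H` and a free group, in which the
letter `t` at level `i` is replaced by the free generator number `κ i`. -/
def levelLift {n : ℕ} (κ : ℤ → Fin (n + 1)) (L : List (ℤˣ × H)) : CoprodFree H (n + 1) :=
  levelEval d η Coprod.inl (fun i => freeLetter H (κ i)) 0 L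

theorem map_levelLift {X : Type} [Group X] {n : ℕ} (κ : ℤ → Fin (n + 1)) (L : List (ℤˣ × H))
    (f : H →* X) (s : Fin (n + 1) → X) :
    evalFree f s (levelLift d η κ L) = levelEval d η f (fun i => s (κ i)) 0 L := by
  rw [levelLift, map_levelEval]
  simp only [evalFree_freeLetter]
  rfl

theorem dichotomy_or_solvableAt (hH : LocallyIndicable H) {L : List (ℤˣ × H)}
    (ih : ∀ M < L.length, DichotomyLE M) {n : ℕ} {κ : ℤ → Fin (n + 1)} {i₀ : Fin (n + 1)}
    (h₀ : ∃ i ∈ levels d η 0 L, κ i = i₀) (h₁ : ∃ i ∈ levels d η 0 L, κ i ≠ i₀) :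
    Dichotomy (wordEval of t L : EqGroup H) ∨ SolvableAt i₀ (levelLift d η κ L) := by
  let s : Fin (n + 1) → EqGroup (CoprodFree H n) :=
    i₀.insertNth t fun j => of (freeLetter H j)
  let φ : CoprodFree H (n + 1) →* EqGroup (CoprodFree H n) := evalFree (of.comp Coprod.inl) s
  have hlen : ((levels d η 0 L).map fun i => if κ i = i₀ then 1 else 0).sum < L.length := by
    rw [← length_levels d η 0 L]
    refine List.sum_map_lt_length (fun i _ => by split_ifs <;> simp) ?_
    simpa using h₁
  have hlen' : ((levels d η 0 L).map fun i => if κ i = i₀ then 0 else 1).sum < L.length := by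
    rw [← length_levels d η 0 L]
    refine List.sum_map_lt_length (fun i _ => by split_ifs <;> simp) ?_
    simpa using h₀
  have hφ : LengthLE ((levels d η 0 L).map fun i => if κ i = i₀ then 1 else 0).sum
      (φ (levelLift d η κ L)) := by
    have h : φ (levelLift d η κ L) = _ := map_levelLift _ _ _ _ _ _
    rw [h]
    refine lengthLE_levelEval d η (Coprod.inl : H →* CoprodFree H n) _ _ (fun i u => ?_) 0 L
    rcases eq_or_ne (κ i) i₀ with hi | hi
    · simpa [hi, s] using LengthLE.t_zpow u
    · obtain ⟨j, hj⟩ := Fin.exists_succAbove_eq hi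
      rw [if_neg hi, ← hj]
      simpa [s] using LengthLE.of (freeLetter H j ^ (u : ℤ)) 0
  rcases ih _ hlen _ (.coprod hH (.freeGroup _)) _ hφ with ⟨k, hk⟩ | ⟨X, _, f, τ, hf, hX⟩
  · let R (τ : EqGroup H) : EqGroup (CoprodFree H n) →* EqGroup H :=
      lift (evalFree of fun _ => t) τ
    have hR (τ : EqGroup H) : R τ (φ (levelLift d η κ L)) =
        levelEval d η of (fun i => if κ i = i₀ then τ else t) 0 L := by
      have : (R τ).comp φ = evalFree of fun i => if i = i₀ then τ else t := by
        refine coprodFree_hom_ext (fun a => by simp [R, φ]) fun i => ?_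
        rcases eq_or_ne i i₀ with rfl | hi
        · simp [R, φ, s]
        · obtain ⟨j, hj⟩ := Fin.exists_succAbove_eq hi
          rw [← hj]
          simp [R, φ, s, Fin.succAbove_ne]
      exact (DFunLike.congr_fun this _).trans (map_levelLift d η κ L of _)
    have h₁ := (R t).map_isConj hk
    have h₂ := (R 1).map_isConj hk
    rw [hR, lift_of] at h₁ h₂
    simp only [ite_self, levelEval_const] at h₁
    refine .inl (.of_isConj (h₁.trans h₂.symm) (ih _ hlen' H hH _ ?_))
    refine lengthLE_levelEval d η (MonoidHom.id H) _ _ (fun i u => ?_) 0 L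
    split_ifs
    · simpa using LengthLE.one 0
    · exact .t_zpow u
  · refine .inr ⟨X, _, f.comp Coprod.inl, i₀.insertNth τ fun j => f (freeLetter H j), ?_, ?_⟩
    · convert hf
      exact coprodFree_hom_ext (fun a => rfl) fun j => by simp
    · rw [← hX, ← MonoidHom.comp_apply]
      refine DFunLike.congr_fun (coprodFree_hom_ext (fun a => by simp [φ]) fun i => ?_) _
      rcases eq_or_ne i i₀ with rfl | hi
      · simp [φ, s]
      · obtain ⟨j, hj⟩ := Fin.exists_succAbove_eq hi
        rw [← hj]
        simp [φ, s]

theorem dichotomy_of_levels (hH : LocallyIndicable H) {L : List (ℤˣ × H)}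
    (ih : ∀ M < L.length, DichotomyLE M) (hsum : (L.map (height d η)).sum = 0)
    {a b : ℤ} (ha : a ∈ levels d η 0 L) (hb : b ∈ levels d η 0 L) (hab : a ≠ b) :
    Dichotomy (wordEval of t L : EqGroup H) := by
  obtain ⟨lo, hlo, hmin⟩ := (levels d η 0 L).toFinset.exists_min_image id ⟨a, by simpa⟩
  obtain ⟨hi, hhi, hmax⟩ := (levels d η 0 L).toFinset.exists_max_image id ⟨a, by simpa⟩
  simp only [List.mem_toFinset, id] at hlo hmin hhi hmax
  have hlt : lo < hi := by
    have := hmin a ha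
    have := hmin b hb
    have := hmax a ha
    have := hmax b hb
    lia
  obtain ⟨n, hn⟩ := Int.le.dest hlt.le
  let κ : ℤ → Fin (n + 1) := fun i => ⟨min (i - lo).toNat n, by lia⟩
  have hκlo : κ lo = 0 := by simp [κ]
  have hκhi : κ hi = Fin.last n := by simp [κ, Fin.ext_iff, ← hn]
  have hne : (0 : Fin (n + 1)) ≠ Fin.last n := by
    simp only [ne_eq, Fin.ext_iff, Fin.val_zero, Fin.val_last]
    lia
  rcases dichotomy_or_solvableAt d η hH ih ⟨lo, hlo, hκlo⟩ ⟨hi, hhi, hκhi ▸ hne.symm⟩ with h | h₀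
  · exact h
  rcases dichotomy_or_solvableAt d η hH ih ⟨hi, hhi, hκhi⟩ ⟨lo, hlo, hκlo ▸ hne⟩ with h | h₁
  · exact h
  obtain ⟨Y, _, f, s, y, χ, hf, hy, hχy, hχ, hv⟩ := exists_shift_of_solvableAt h₀ h₁
  rw [map_levelLift] at hv
  let f' : H →* Y := MonoidHom.mk' (fun h => f h * y ^ (η h).toAdd) fun g h => by
    rw [map_mul, map_mul, toAdd_mul, zpow_add]
    simpa only [mul_assoc] using
      congrArg (f g * · * y ^ (η h).toAdd) ((hy h).zpow_left (η g).toAdd).eq.symm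
  have hf' : Function.Injective f' := by
    refine (injective_iff_map_eq_one f').2 fun h hh => ?_
    have h1 : f h * y ^ (η h).toAdd = 1 := hh
    have h2 := congrArg χ h1
    rw [map_mul, hχ, map_zpow, hχy, one_mul, MonoidHom.map_one, ← Int.ofAdd_mul, one_mul] at h2
    have h3 : (η h).toAdd = 0 := h2
    rw [h3, zpow_zero, mul_one] at h1
    exact (injective_iff_map_eq_one f).1 hf h h1
  refine .inr ⟨Y, _, f', (y ^ (-lo) * s * y ^ lo) * y ^ d, hf', ?_⟩
  have key := zpow_mul_wordEval d η f y (y ^ (-lo) * s * y ^ lo) hy f' (fun _ => rfl) 0 L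
  rw [hsum, levelEval_congr d η f (s' := fun i => y ^ (κ i : ℤ) * s * y ^ (-(κ i : ℤ))), hv] at key
  · simpa [lift_wordEval] using key
  · intro i hi
    have h1 := hmin i hi
    have h2 := hmax i hi
    have : ((κ i : ℕ) : ℤ) = i - lo := by simp only [κ]; lia
    rw [this, neg_sub, sub_eq_add_neg, sub_eq_add_neg, zpow_add, zpow_add]
    simp only [mul_assoc]

end EqGroup

section AltWord

variable {A B X Y : Type} [Group A] [Group B] [Group X] [Group Y]

/-- The alternating product of the `f b * g a`, over the pairs `(a, b)` in a list. -/
def altEval (g : A →* X) (f : B →* X) (L : List (A × B)) : X := (L.map fun p => f p.2 * g p.1).prod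

@[simp]
theorem altEval_nil (g : A →* X) (f : B →* X) : altEval g f [] = 1 := rfl

@[simp]
theorem altEval_cons (g : A →* X) (f : B →* X) (p : A × B) (L : List (A × B)) :
    altEval g f (p :: L) = f p.2 * g p.1 * altEval g f L := by simp [altEval]

@[simp]
theorem altEval_append (g : A →* X) (f : B →* X) (L M : List (A × B)) :
    altEval g f (L ++ M) = altEval g f L * altEval g f M := by simp [altEval]

theorem map_altEval (h : X →* Y) (g : A →* X) (f : B →* X) (L : List (A × B)) :
    h (altEval g f L) = altEval (h.comp g) (h.comp f) L := by
  simp [altEval, map_list_prod, Function.comp_def]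

theorem isConj_altEval_append (g : A →* X) (f : B →* X) (L M : List (A × B)) :
    IsConj (altEval g f (L ++ M)) (altEval g f (M ++ L)) :=
  isConj_iff.2 ⟨(altEval g f L)⁻¹, by simp⟩

theorem exists_altEval (r : Coprod A B) : ∃ L, r = altEval Coprod.inl Coprod.inr L := by
  induction r using Coprod.induction_on with
  | inl a => exact ⟨[(a, 1)], by simp⟩
  | inr b => exact ⟨[(1, b)], by simp⟩
  | mul x y hx hy =>
    obtain ⟨L, rfl⟩ := hx
    obtain ⟨M, rfl⟩ := hy
    exact ⟨L ++ M, by simp⟩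

/-- `x` is conjugate to an element of one of the factors, or to an alternating product of at most
`2 * N` nontrivial letters. -/
def ConjAltLE (N : ℕ) (x : Coprod A B) : Prop :=
  (∃ a, IsConj x (Coprod.inl a)) ∨ (∃ b, IsConj x (Coprod.inr b)) ∨
    ∃ M : List (A × B), M.length ≤ N ∧ M ≠ [] ∧ (∀ p ∈ M, p.1 ≠ 1 ∧ p.2 ≠ 1) ∧
      IsConj x (altEval Coprod.inl Coprod.inr M)

theorem ConjAltLE.of_isConj {N N' : ℕ} {x y : Coprod A B} (hy : ConjAltLE N y) (hN : N ≤ N')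
    (h : IsConj x y) : ConjAltLE N' x :=
  hy.imp (fun ⟨a, ha⟩ => ⟨a, h.trans ha⟩) (Or.imp (fun ⟨a, ha⟩ => ⟨a, h.trans ha⟩)
    fun ⟨M, hM, h', h'', ha⟩ => ⟨M, hM.trans hN, h', h'', h.trans ha⟩)

theorem conjAltLE_altEval (L : List (A × B)) :
    ConjAltLE L.length (altEval Coprod.inl Coprod.inr L : Coprod A B) := by
  induction hn : L.length using Nat.strong_induction_on generalizing L with | _ n ih
  rcases eq_or_ne L [] with rfl | hne
  · exact .inl ⟨1, by simp⟩
  by_cases h : ∀ p ∈ L, p.1 ≠ 1 ∧ p.2 ≠ 1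
  · exact .inr (.inr ⟨L, hn.le, hne, h, .refl _⟩)
  push Not at h
  obtain ⟨p, hp, h⟩ := h
  obtain ⟨C, D, rfl⟩ := List.append_of_mem hp
  refine .of_isConj ?_ le_rfl (isConj_altEval_append _ _ C (p :: D))
  have hlen : (D ++ C).length + 1 = n := by
    rw [← hn]
    simp only [List.length_append, List.length_cons]
    lia
  rw [List.cons_append]
  generalize D ++ C = M at *
  by_cases h1 : p.1 = 1
  · rcases M with - | ⟨p', M⟩
    · exact .inr (.inl ⟨p.2, isConj_iff.2 ⟨1, by simp [h1]⟩⟩)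
    · refine .of_isConj (ih (M.length + 1) ?_ ((p'.1, p.2 * p'.2) :: M) rfl) ?_ ?_
      · simp only [List.length_cons] at hlen
        lia
      · simp only [List.length_cons] at hlen
        lia
      · exact isConj_iff.2 ⟨1, by simp [h1, mul_assoc]⟩
  · rcases M.eq_nil_or_concat with rfl | ⟨M, p', rfl⟩
    · exact .inl ⟨p.1, isConj_iff.2 ⟨1, by simp [h h1]⟩⟩
    · rw [List.length_concat] at hlen
      refine .of_isConj (ih (M.length + 1) (by lia) (M ++ [(p'.1 * p.1, p'.2)]) (by simp))
        (by lia) (isConj_iff.2 ⟨(Coprod.inl p.1)⁻¹, ?_⟩)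
      simp [h h1, mul_assoc]

/-- The word in `t` and `A × B` obtained from an alternating product by conjugating the second
factor by `t`. -/
def altWord (L : List (A × B)) : List (ℤˣ × (A × B)) :=
  L.flatMap fun p => [(1, (1, p.2)), (-1, (p.1, 1))]

theorem length_altWord (L : List (A × B)) : (altWord L).length = 2 * L.length := by
  simp [altWord, mul_comm]

theorem wordEval_altWord (f : A × B →* X) (τ : X) (L : List (A × B)) :
    wordEval f τ (altWord L) = altEval (f.comp (MonoidHom.inl A B))
      ((MulAut.conj τ).toMonoidHom.comp (f.comp (MonoidHom.inr A B))) L := by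
  induction L with
  | nil => rfl
  | cons p L ih =>
    simp only [altWord, List.flatMap_cons, wordEval_append] at ih ⊢
    rw [ih]
    simp [mul_assoc]

theorem isChain_altWord {L : List (A × B)} (hL : ∀ p ∈ L, p.1 ≠ 1 ∧ p.2 ≠ 1) :
    (altWord L ++ altWord L).IsChain (Reduced (⊥ : Subgroup (A × B)) ⊥) := by
  refine EqGroup.isChain_reduced_append_self fun p hp => ?_
  obtain ⟨q, hq, hp⟩ := List.mem_flatMap.1 hp
  simp only [List.mem_cons, List.not_mem_nil, or_false] at hp
  rcases hp with rfl | rfl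
  · exact fun h => (hL q hq).2 (congrArg Prod.snd h)
  · exact fun h => (hL q hq).1 (congrArg Prod.fst h)

theorem altWord_ne_nil {L : List (A × B)} (hL : L ≠ []) : altWord L ≠ [] := by
  intro h
  have := length_altWord L
  simp [h] at this
  exact hL this

end AltWord

theorem exists_levels_ne {H : Type} [Group H] (η : H →* Multiplicative ℤ) {L : List (ℤˣ × H)}
    (h : ∃ p ∈ L, η p.2 ≠ 1) (hsum : (L.map (height 0 η)).sum = 0) (c : ℤ) :
    ∃ i ∈ levels 0 η c L, i ≠ c := by
  by_contra! hc
  obtain ⟨p, hp, h⟩ := h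
  apply h
  clear h
  induction L generalizing p with
  | nil => simp at hp
  | cons p' L ih =>
    have hp' : height 0 η p' = 0 := by
      cases L with
      | nil => simpa using hsum
      | cons q L =>
        simpa [levels, letterLevel] using hc (c + height 0 η p') (by simp [levels, letterLevel])
    rcases List.mem_cons.1 hp with rfl | hp
    · exact Multiplicative.toAdd.injective (by simpa [height] using hp')
    · exact ih (by simpa [hp'] using hsum) (fun i hi => hc i (by simp [levels, hp', hi])) p hp

theorem LocallyIndicable.exists_hom_closure {H : Type} [Group H] (hH : LocallyIndicable H)
    {s : Set H} (hs : s.Finite) (h : ∃ x ∈ s, x ≠ 1) :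
    ∃ (η : Subgroup.closure s →* Multiplicative ℤ) (x : H) (hx : x ∈ s),
      η ⟨x, Subgroup.subset_closure hx⟩ ≠ 1 := by
  obtain ⟨x, hx, h⟩ := h
  have : Finite s := hs
  have : Group.FG (Subgroup.closure s) := Group.closure_finite_fg s
  have : Nontrivial (Subgroup.closure s) :=
    ⟨⟨x, Subgroup.subset_closure hx⟩, 1, fun h' => h (congrArg Subtype.val h')⟩
  obtain ⟨η, hη⟩ := hH.of_injective (Subgroup.closure s).subtype Subtype.val_injective
    |>.exists_hom_ne_one
  by_contra! hc
  refine hη (MonoidHom.eq_of_eqOn_dense (Subgroup.closure_closure_coe_preimage (k := s)) ?_)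
  exact fun y hy => hc η y hy

namespace EqGroup

variable {A B : Type} [Group A] [Group B]

theorem exists_altEval_eq_one_of_hom (hA : LocallyIndicable A) (hB : LocallyIndicable B)
    {L : List (A × B)} (hne : L ≠ []) (hL : ∀ p ∈ L, p.1 ≠ 1 ∧ p.2 ≠ 1)
    (ih : ∀ M < 2 * L.length, DichotomyLE M) (α : A →* Multiplicative ℤ)
    (β : B →* Multiplicative ℤ) (hα : ∃ p ∈ L, α p.1 ≠ 1) (hβ : ∃ p ∈ L, β p.2 ≠ 1) :
    ∃ (X : Type) (_ : Group X) (g : A →* X) (f : B →* X),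
      Function.Injective g ∧ Function.Injective f ∧ altEval g f L = 1 := by
  obtain ⟨u, v, huv, h0⟩ : ∃ u v : ℤ, (u ≠ 0 ∨ v ≠ 0) ∧
      u * (L.map fun p => (α p.1).toAdd).sum + v * (L.map fun p => (β p.2).toAdd).sum = 0 := by
    by_cases h : (L.map fun p => (α p.1).toAdd).sum = 0
    · exact ⟨1, 0, by simp, by simp [h]⟩
    · exact ⟨_, -_, .inr (neg_ne_zero.2 h), by rw [mul_comm, neg_mul, add_neg_cancel]⟩
  let η : A × B →* Multiplicative ℤ :=
    (α.comp (MonoidHom.fst A B)) ^ u * (β.comp (MonoidHom.snd A B)) ^ v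
  have hη (a : A) (b : B) : (η (a, b)).toAdd = u * (α a).toAdd + v * (β b).toAdd := by
    simp [η, toAdd_mul, toAdd_zpow]
  have hsum : ((altWord L).map (height 0 η)).sum = 0 := by
    refine Eq.trans ?_ h0
    clear * - hη
    induction L with
    | nil => simp [altWord]
    | cons p L ih =>
      simp only [altWord, List.flatMap_cons, List.map_append, List.sum_append] at ih ⊢
      rw [ih]
      simp [height, hη]
      ring
  have hη1 : ∃ p ∈ altWord L, η p.2 ≠ 1 := by
    rcases huv with hu | hv
    · obtain ⟨p, hp, h⟩ := hα
      refine ⟨(-1, (p.1, 1)), List.mem_flatMap.2 ⟨p, hp, by simp⟩, fun h' => h ?_⟩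
      have := hη p.1 1
      rw [h'] at this
      simpa [hu] using this
    · obtain ⟨p, hp, h⟩ := hβ
      refine ⟨(1, (1, p.2)), List.mem_flatMap.2 ⟨p, hp, by simp⟩, fun h' => h ?_⟩
      have := hη 1 p.2
      rw [h'] at this
      simpa [hv] using this
  obtain ⟨i, hi, hi0⟩ := exists_levels_ne η hη1 hsum 0
  have h0' : (0 : ℤ) ∈ levels 0 η 0 (altWord L) := by
    obtain ⟨p, L, rfl⟩ := List.exists_cons_of_ne_nil hne
    simp [altWord, levels, letterLevel]
  rcases dichotomy_of_levels 0 η (hA.prod hB) (by rwa [length_altWord]) hsum hi h0' hi0 with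
    ⟨h, hh⟩ | ⟨X, _, f, τ, hf, hX⟩
  · exact absurd hh (not_isConj_of (isChain_altWord hL) (altWord_ne_nil hne) h)
  · rw [lift_wordEval, wordEval_altWord] at hX
    refine ⟨X, _, _, _, ?_, ?_, hX⟩
    · exact hf.comp (Prod.mk_left_injective 1)
    · exact (MulAut.conj τ).injective.comp (hf.comp (Prod.mk_right_injective 1))

theorem exists_altEval_eq_one (hA : LocallyIndicable A) (hB : LocallyIndicable B)
    {L : List (A × B)} (hne : L ≠ []) (hL : ∀ p ∈ L, p.1 ≠ 1 ∧ p.2 ≠ 1)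
    (ih : ∀ M < 2 * L.length, DichotomyLE M) :
    ∃ (X : Type) (_ : Group X) (g : A →* X) (f : B →* X),
      Function.Injective g ∧ Function.Injective f ∧ altEval g f L = 1 := by
  obtain ⟨p, hp⟩ := List.exists_mem_of_ne_nil L hne
  let sA : Set A := {a | a ∈ L.map Prod.fst}
  let sB : Set B := {b | b ∈ L.map Prod.snd}
  have mA {p} (hp : p ∈ L) : p.1 ∈ sA := List.mem_map_of_mem hp
  have mB {p} (hp : p ∈ L) : p.2 ∈ sB := List.mem_map_of_mem hp
  obtain ⟨α, a, ha, hα⟩ := hA.exists_hom_closure (List.finite_toSet _) ⟨p.1, mA hp, (hL p hp).1⟩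
  obtain ⟨β, b, hb, hβ⟩ := hB.exists_hom_closure (List.finite_toSet _) ⟨p.2, mB hp, (hL p hp).2⟩
  let A₀ := Subgroup.closure sA
  let B₀ := Subgroup.closure sB
  have hrange : L ∈ Set.range (List.map (Prod.map A₀.subtype B₀.subtype)) := by
    rw [Set.range_list_map]
    exact fun p hp => ⟨(⟨p.1, Subgroup.subset_closure (mA hp)⟩,
      ⟨p.2, Subgroup.subset_closure (mB hp)⟩), rfl⟩
  obtain ⟨L₀, hL₀⟩ := hrange
  have hmap {p} (hp : p ∈ L₀) : ((p.1 : A), (p.2 : B)) ∈ L := hL₀ ▸ List.mem_map_of_mem hp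
  have hmem {p} (hp : p ∈ L) : ∃ q ∈ L₀, (q.1 : A) = p.1 ∧ (q.2 : B) = p.2 := by
    rw [← hL₀] at hp
    obtain ⟨q, hq, rfl⟩ := List.mem_map.1 hp
    exact ⟨q, hq, rfl, rfl⟩
  have hα' : ∃ q ∈ L₀, α q.1 ≠ 1 := by
    obtain ⟨p, hp, rfl⟩ := List.mem_map.1 ha
    obtain ⟨q, hq, h, -⟩ := hmem hp
    exact ⟨q, hq, by convert hα⟩
  have hβ' : ∃ q ∈ L₀, β q.2 ≠ 1 := by
    obtain ⟨p, hp, rfl⟩ := List.mem_map.1 hb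
    obtain ⟨q, hq, -, h⟩ := hmem hp
    exact ⟨q, hq, by convert hβ⟩
  obtain ⟨X, _, g, f, hg, hf, hX⟩ := exists_altEval_eq_one_of_hom
    (hA.of_injective A₀.subtype Subtype.val_injective)
    (hB.of_injective B₀.subtype Subtype.val_injective) (L := L₀)
    (by rintro rfl; exact hne hL₀.symm)
    (fun p hp => by simpa using hL _ (hmap hp)) (by simpa [← hL₀] using ih) α β hα' hβ'
  obtain ⟨Y, _, a, b, ha, hb, hab⟩ := exists_amalgam A₀.subtype g Subtype.val_injective hg
  obtain ⟨Z, _, c, d, hc, hd, hcd⟩ := exists_amalgam B₀.subtype (b.comp f)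
    Subtype.val_injective (hb.comp hf)
  refine ⟨Z, _, d.comp a, c, hd.comp ha, hc, ?_⟩
  have := congrArg (d.comp b) hX
  rw [map_altEval, map_one] at this
  rw [← this, ← hL₀]
  simp only [altEval, List.map_map]
  congr 2
  funext p
  simp only [Function.comp_apply, Prod.map_fst, Prod.map_snd, hcd, MonoidHom.comp_apply, hab]

end EqGroup

namespace EqGroup

/-- Expansion of alternating pairs of coefficients into a word with alternating exponents. -/
def expand {H : Type} (M : List (H × H)) : List (ℤˣ × H) := M.flatMap fun p => [(1, p.2), (-1, p.1)]

theorem length_expand {H : Type} (M : List (H × H)) : (expand M).length = 2 * M.length := by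
  simp [expand, mul_comm]

variable {H X : Type} [Group H] [Group X]

theorem wordEval_expand (f : H →* X) (τ : X) (M : List (H × H)) :
    wordEval f τ (expand M) = altEval f ((MulAut.conj τ).toMonoidHom.comp f) M := by
  induction M with
  | nil => rfl
  | cons p M ih =>
    simp only [expand, List.flatMap_cons, wordEval_append] at ih ⊢
    rw [ih]
    simp [mul_assoc]

theorem exists_eq_expand {H : Type} : ∀ L : List (ℤˣ × H), L.IsChain (fun a b => a.1 ≠ b.1) →
    (∀ p ∈ L.head?, p.1 = 1) → (∀ p ∈ L.getLast?, p.1 = -1) → ∃ M, L = expand M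
  | [], _, _, _ => ⟨[], rfl⟩
  | [p], _, h1, h2 => by simp [h1 p rfl] at h2
  | p :: q :: L, hc, h1, h2 => by
    obtain ⟨hpq, hc⟩ := List.isChain_cons_cons.1 hc
    have hp : p.1 = 1 := h1 p rfl
    have hq : q.1 = -1 := (Int.units_eq_one_or q.1).resolve_left fun h => hpq (hp.trans h.symm)
    obtain ⟨hqL, hc⟩ := List.isChain_cons.1 hc
    obtain ⟨M, rfl⟩ := exists_eq_expand L hc
      (fun x hx => (Int.units_eq_one_or x.1).resolve_right fun h => hqL x hx (hq.trans h.symm))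
      fun x hx => h2 x <| by
        rw [List.getLast?_cons_cons, List.getLast?_cons]
        rw [Option.mem_def] at hx
        simp [hx]
    exact ⟨(q.2, p.2) :: M, by simp [expand, Prod.ext_iff, hp, hq]⟩

theorem exists_conj_expand {L : List (ℤˣ × H)} (hne : L ≠ [])
    (hL : (L ++ L).IsChain fun a b => a.1 ≠ b.1) :
    ∃ M, 2 * M.length = L.length ∧
      IsConj (wordEval of t L : EqGroup H) (wordEval of t (expand M)) := by
  obtain ⟨p, L, rfl⟩ := List.exists_cons_of_ne_nil hne
  obtain ⟨hc, -, hadj⟩ := List.isChain_append.1 hL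
  rcases Int.units_eq_one_or p.1 with hp | hp
  · obtain ⟨M, hM⟩ := exists_eq_expand _ hc (by simpa using hp) fun x hx =>
      (Int.units_eq_one_or x.1).resolve_left fun h => hadj x hx p rfl (h.trans hp.symm)
    exact ⟨M, by rw [hM, length_expand], by rw [hM]⟩
  · have hadj' : ∀ x ∈ (L ++ [p]).head?, x.1 ≠ p.1 := by
      cases L with
      | nil => exact absurd rfl (hadj p rfl p rfl)
      | cons q L =>
        rintro x ⟨⟩
        exact (List.isChain_cons_cons.1 hc).1.symm
    have hc' : (L ++ [p]).IsChain fun a b => a.1 ≠ b.1 := hL.infix ⟨[p], L, by simp⟩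
    obtain ⟨M, hM⟩ := exists_eq_expand _ hc'
      (fun x hx => (Int.units_eq_one_or x.1).resolve_right fun h => hadj' x hx (h.trans hp.symm))
      (by simpa using hp)
    refine ⟨M, by rw [← length_expand, ← hM]; simp, ?_⟩
    rw [← hM]
    exact isConj_wordEval_append _ _ [p] L

theorem dichotomy_of_isChain (hH : LocallyIndicable H) {L : List (ℤˣ × H)} (hne : L ≠ [])
    (ih : ∀ M < L.length, DichotomyLE M) (hL : (L ++ L).IsChain fun a b => a.1 ≠ b.1) :
    Dichotomy (wordEval of t L : EqGroup H) := by
  obtain ⟨M, hM, hconj⟩ := exists_conj_expand hne hL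
  refine .of_isConj hconj ?_
  rw [wordEval_expand]
  let ψ : Coprod H H →* EqGroup H := Coprod.lift of ((MulAut.conj t).toMonoidHom.comp of)
  have hψ : ψ (altEval Coprod.inl Coprod.inr M) =
      altEval of ((MulAut.conj t).toMonoidHom.comp of) M := map_altEval _ _ _ _
  rcases conjAltLE_altEval M with ⟨a, ha⟩ | ⟨b, hb⟩ | ⟨M', hlen, hne', hM', hc⟩
  · have := ψ.map_isConj ha
    rw [hψ] at this
    exact .inl ⟨a, this⟩
  · have := ψ.map_isConj hb
    rw [hψ] at this
    exact .inl ⟨b, this.trans (IsConj.symm (isConj_iff.2 ⟨t, rfl⟩))⟩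
  · obtain ⟨X, _, g, f, hg, hf, hX⟩ := exists_altEval_eq_one hH hH hne' hM'
      fun k hk => ih k (by lia)
    obtain ⟨Y, _, j, y, -, hj, hy, -⟩ := exists_conj_extension g f hg hf
    refine .inr ⟨Y, _, j.comp g, y, hj.comp hg, ?_⟩
    have h1 := (Coprod.lift g f).map_isConj hc
    rw [map_altEval, map_altEval, Coprod.lift_comp_inl, Coprod.lift_comp_inr, hX,
      isConj_one_left] at h1
    have h2 := congrArg j h1
    rw [map_altEval, map_one] at h2
    have hfy : (MulAut.conj y).toMonoidHom.comp (j.comp g) = j.comp f := MonoidHom.ext hy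
    rw [← wordEval_expand, lift_wordEval, wordEval_expand, hfy, h2]

theorem Dichotomy.of_lift {s s' : EqGroup H} (hs : lift of s' s = t) {g : EqGroup H}
    (h : Dichotomy (lift of s g)) : Dichotomy g := by
  refine h.imp (fun ⟨a, ha⟩ => ⟨a, ?_⟩) fun ⟨X, _, f, τ, hf, hX⟩ => ⟨X, _, f, lift f τ s, hf, ?_⟩
  · have := (lift of s').map_isConj ha
    rw [← MonoidHom.comp_apply, show (lift of s').comp (lift of s) = MonoidHom.id _ from
      hom_ext (by simp) (by simpa using hs)] at this
    simpa using this
  · rw [← hX, ← MonoidHom.comp_apply]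
    exact DFunLike.congr_fun (hom_ext (by simp) (by simp)) g

/-- The correction in front of a word when `t ^ u` is replaced by `t ^ u * k`. -/
def twistPost (u : ℤˣ) (k : H) : List (ℤˣ × H) → H
  | [] => 1
  | p :: _ => if p.1 = u then 1 else k⁻¹

/-- The word obtained when `t ^ u` is replaced by `t ^ u * k`. -/
def twist (u : ℤˣ) (k : H) : List (ℤˣ × H) → List (ℤˣ × H)
  | [] => []
  | p :: L => (p.1, (if p.1 = u then k else 1) * p.2 * twistPost u k L) :: twist u k L

theorem map_fst_twist (u : ℤˣ) (k : H) (L : List (ℤˣ × H)) :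
    (twist u k L).map Prod.fst = L.map Prod.fst := by
  induction L with
  | nil => rfl
  | cons p L ih => simp [twist, ih]

theorem wordEval_twist (u : ℤˣ) (k : H) (f : H →* X) (τ : X) (L : List (ℤˣ × H)) :
    wordEval f ((τ ^ (u : ℤ) * f k) ^ (u : ℤ)) L =
      f (twistPost u k L) * wordEval f τ (twist u k L) := by
  induction L with
  | nil => simp [twistPost, twist]
  | cons p L ih =>
    rw [wordEval_cons, ih, twist, wordEval_cons, twistPost]
    rcases eq_or_ne p.1 u with hp | hp
    · have : ((u : ℤ) * u) = 1 := Int.units_coe_mul_self u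
      rw [hp, ← zpow_mul, this]
      simp [mul_assoc]
    · have hp' : p.1 = -u := Int.units_ne_iff_eq_neg.1 hp
      have : ((u : ℤ) * (p.1 : ℤˣ)) = -1 := by
        rw [hp', Units.val_neg, mul_neg, Int.units_coe_mul_self]
      rw [← zpow_mul, this, zpow_neg_one, mul_inv_rev, ← zpow_neg, if_neg hp, if_neg hp, hp']
      simp [mul_assoc]

theorem dichotomy_of_sum_ne_zero (hH : LocallyIndicable H) {L : List (ℤˣ × H)} {u : ℤˣ} {h : H}
    (ih : ∀ M < L.length + 2, DichotomyLE M)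
    (hsum : (((u, 1) :: (u, h) :: L).map fun p => (p.1 : ℤ)).sum ≠ 0) :
    Dichotomy (wordEval of t ((u, 1) :: (u, h) :: L) : EqGroup H) := by
  generalize hL : (u, 1) :: (u, h) :: L = L₁ at *
  by_cases hone : ∀ p ∈ L₁, p.2 = 1
  · refine .inr ⟨H, _, MonoidHom.id H, 1, Function.injective_id, ?_⟩
    rw [lift_wordEval]
    exact List.prod_eq_one (by simpa [wordEval] using fun a u h => hone (u, a) h)
  push Not at hone
  obtain ⟨p, hp, hp1⟩ := hone
  let s : Set H := {a | a ∈ L₁.map Prod.snd}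
  have hs {p} (hp : p ∈ L₁) : p.2 ∈ s := List.mem_map_of_mem hp
  obtain ⟨η, a, ha, hη⟩ := hH.exists_hom_closure (List.finite_toSet _) ⟨p.2, hs hp, hp1⟩
  have hrange : L₁ ∈ Set.range (List.map (Prod.map id (Subgroup.closure s).subtype)) := by
    rw [Set.range_list_map]
    exact fun p hp => ⟨(p.1, ⟨p.2, Subgroup.subset_closure (hs hp)⟩), rfl⟩
  obtain ⟨L₀, hL₀⟩ := hrange
  have hη' : ∃ q ∈ L₀, η q.2 ≠ 1 := by
    obtain ⟨p, hp, rfl⟩ := List.mem_map.1 ha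
    rw [← hL₀] at hp
    obtain ⟨q, hq, rfl⟩ := List.mem_map.1 hp
    exact ⟨q, hq, hη⟩
  have hsum₀ : (L₀.map fun p => (p.1 : ℤ)).sum ≠ 0 := by
    rw [← hL₀, List.map_map] at hsum
    exact hsum
  have hlen : L₀.length = L.length + 2 := by
    rw [← hL] at hL₀
    simpa using congrArg List.length hL₀
  have hword : wordEval of t L₁ = lift ((of : H →* EqGroup H).comp (Subgroup.closure s).subtype) t
      (wordEval of t L₀) := by
    rw [lift_wordEval, ← hL₀]
    simp [wordEval, Function.comp_def]
  rw [hword]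
  refine .map_of_injective _ Subtype.val_injective ?_
  set σ := (L₀.map fun p => (p.1 : ℤ)).sum
  let d : ℤ := -(L₀.map fun p => (η p.2).toAdd).sum
  have hheight : (L₀.map (height d (η ^ σ))).sum = 0 := by
    have (L : List (ℤˣ × Subgroup.closure s)) : (L.map (height d (η ^ σ))).sum =
        (L.map fun p => (p.1 : ℤ)).sum * d + σ * (L.map fun p => (η p.2).toAdd).sum := by
      induction L with
      | nil => simp
      | cons p L ih =>
        simp [ih, height, toAdd_zpow]
        ring
    rw [this]
    simp [d, σ]
  have hstart : ∃ (x : Subgroup.closure s) (M : List _), x = 1 ∧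
      ∃ y, L₀ = (u, x) :: (u, y) :: M := by
    rw [← hL] at hL₀
    match L₀, hL₀ with
    | p :: q :: M, hL₀ =>
      simp only [List.map_cons, List.cons.injEq, Prod.map, id, Prod.mk.injEq] at hL₀
      refine ⟨p.2, M, Subtype.ext hL₀.1.2, q.2, ?_⟩
      simp [Prod.ext_iff, hL₀.1.1, hL₀.2.1.1]
  obtain ⟨x, M, rfl, y, hM⟩ := hstart
  have ih' : ∀ M < L₀.length, DichotomyLE M := by rwa [hlen]
  have hH' := hH.of_injective (Subgroup.closure s).subtype Subtype.val_injective
  by_cases hd : d = 0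
  · rw [hd] at hheight
    obtain ⟨i, hi, hi0⟩ := exists_levels_ne (η ^ σ) (L := L₀) (by
      obtain ⟨q, hq, h⟩ := hη'
      refine ⟨q, hq, fun h' => h ?_⟩
      have h₀ : σ * (η q.2).toAdd = 0 := by
        simpa [toAdd_zpow] using congrArg Multiplicative.toAdd h'
      exact toAdd_eq_zero.1 ((mul_eq_zero.1 h₀).resolve_left hsum₀)) hheight 0
    refine dichotomy_of_levels 0 (η ^ σ) hH' ih' hheight hi ?_ hi0
    rw [hM]
    simp [levels, letterLevel]
  · refine dichotomy_of_levels d (η ^ σ) hH' ih' hheight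
      (a := letterLevel d 0 (u, (1 : Subgroup.closure s)))
      (b := letterLevel d (u * d) (u, y)) ?_ ?_ ?_
    · rw [hM]
      simp [levels]
    · rw [hM]
      simp [levels, height]
    · rcases Int.units_eq_one_or u with rfl | rfl
      · simp [letterLevel, Ne.symm hd]
      · simpa [letterLevel, eq_comm (a := -d)] using hd

theorem dichotomy_of_fst_eq (hH : LocallyIndicable H) {L : List (ℤˣ × H)} {u : ℤˣ} {h h' : H}
    (ih : ∀ M < L.length + 2, DichotomyLE M) :
    Dichotomy (wordEval of t ((u, h) :: (u, h') :: L) : EqGroup H) := by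
  by_cases hsum : (((u, h) :: (u, h') :: L).map fun p => (p.1 : ℤ)).sum = 0
  · have hheight : height (H := H) 1 1 = fun p => (p.1 : ℤ) := funext fun p => by simp [height]
    refine dichotomy_of_levels 1 1 hH ih (by rwa [hheight])
      (a := letterLevel 1 0 (u, h)) (b := letterLevel 1 u (u, h')) ?_ ?_ ?_
    · simp [levels]
    · simp [levels, height]
    · rcases Int.units_eq_one_or u with rfl | rfl <;> simp [letterLevel]
  · refine .of_lift (s := (t ^ (u : ℤ) * of h⁻¹) ^ (u : ℤ)) (s' := (t ^ (u : ℤ) * of h) ^ (u : ℤ))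
      ?_ ?_
    · have hu : ((u : ℤ) * u) = 1 := Int.units_coe_mul_self u
      simp [← zpow_mul, hu]
    · have hsign := congrArg (List.map ((↑) : ℤˣ → ℤ))
        (map_fst_twist u h⁻¹ ((u, h) :: (u, h') :: L))
      have hlen := congrArg List.length (map_fst_twist u h⁻¹ L)
      rw [lift_wordEval, wordEval_twist]
      simp only [twist, twistPost, if_true, map_one, one_mul, inv_mul_cancel, mul_one] at hsign ⊢
      refine dichotomy_of_sum_ne_zero hH
        (by rwa [show (twist u h⁻¹ L).length = L.length by simpa using hlen]) ?_
      simpa [← Function.comp_def, ← List.map_map, map_fst_twist] using hsum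

theorem dichotomy_wordEval (hH : LocallyIndicable H) {L : List (ℤˣ × H)} (hne : L ≠ [])
    (ih : ∀ M < L.length, DichotomyLE M) : Dichotomy (wordEval of t L : EqGroup H) := by
  rcases L.exists_rotation (fun a b => a.1 ≠ b.1) with
    h | ⟨⟨u, a⟩, rfl, -⟩ | ⟨A, B, a, b, C, rfl, hC, hab⟩
  · exact dichotomy_of_isChain hH hne ih h
  · refine .inr ⟨H, _, MonoidHom.id H, a⁻¹ ^ (u : ℤ), Function.injective_id, ?_⟩
    have : ((u : ℤ) * u) = 1 := Int.units_coe_mul_self u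
    simp [← zpow_mul, this]
  · refine .of_isConj (isConj_wordEval_append _ _ _ _) ?_
    have hlen := congrArg List.length hC
    obtain ⟨u, a⟩ := a
    obtain ⟨v, b⟩ := b
    obtain rfl : u = v := not_not.1 hab
    rw [hC]
    refine dichotomy_of_fst_eq hH fun M hM => ih M ?_
    simp at hlen ⊢
    lia

theorem dichotomyLE (N : ℕ) : DichotomyLE N := by
  induction N using Nat.strong_induction_on with | _ N ih
  rintro H _ hH _ ⟨h, L, hL, rfl⟩
  rcases isConj_of_or_wordEval h L with ⟨g, hg⟩ | ⟨M, hne, hM, hc⟩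
  · exact .inl ⟨g, hg⟩
  · exact .of_isConj hc (dichotomy_wordEval hH hne fun k hk => ih k (by lia))

end EqGroup

theorem LocallyIndicable.coprod_dichotomy {A B : Type} [Group A] [Group B]
    (hA : LocallyIndicable A) (hB : LocallyIndicable B) (r : Coprod A B) :
    (∃ a, IsConj r (Coprod.inl a)) ∨ (∃ b, IsConj r (Coprod.inr b)) ∨
      ∃ (X : Type) (_ : Group X) (g : A →* X) (f : B →* X),
        Function.Injective g ∧ Function.Injective f ∧ Coprod.lift g f r = 1 := by
  obtain ⟨L, rfl⟩ := exists_altEval r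
  refine (conjAltLE_altEval L).imp_right (Or.imp_right ?_)
  rintro ⟨M, -, hne, hM, hc⟩
  obtain ⟨X, _, g, f, hg, hf, hX⟩ := EqGroup.exists_altEval_eq_one hA hB hne hM
    fun k _ => EqGroup.dichotomyLE k
  refine ⟨X, _, g, f, hg, hf, ?_⟩
  have h := (Coprod.lift g f).map_isConj hc
  rwa [map_altEval (Coprod.lift g f) Coprod.inl Coprod.inr M, Coprod.lift_comp_inl,
    Coprod.lift_comp_inr, hX, isConj_one_left] at h

theorem rhoWord_eq_one_iff {G : Type*} [Group G] {k : ℕ} {x t : G} :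
    rhoWord k x t = 1 ↔ t * x * t⁻¹ * x = x ^ (k + 1) * (t * x * t⁻¹) := by
  rw [rhoWord, zpow_neg, mul_inv_eq_one, mul_inv_eq_iff_eq_mul]
  norm_cast

theorem map_rhoWord {G H : Type*} [Group G] [Group H] (f : G →* H) (k : ℕ) (x t : G) :
    f (rhoWord k x t) = rhoWord k (f x) (f t) := by
  simp [rhoWord]

namespace LocallyIndicable

theorem real : LocallyIndicable (Multiplicative ℝ) := by
  intro S _ _ _ i hi
  let R : AddSubgroup ℝ := (MonoidHom.toAdditiveLeft i).range
  have hR : AddGroup.FG R := inferInstance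
  have : Module.Finite ℤ R := Module.Finite.iff_addGroup_fg.2 hR
  obtain ⟨s, hs⟩ := exists_ne (1 : S)
  have hs' : (MonoidHom.toAdditiveLeft i).rangeRestrict (.ofMul s) ≠ 0 := fun h =>
    hs (hi ((congrArg Subtype.val h).trans i.map_one.symm))
  obtain ⟨ψ, hψ⟩ := not_forall.1 (mt (Module.forall_dual_apply_eq_zero_iff ℤ _).1 hs')
  exact ⟨AddMonoidHom.toMultiplicativeRight
    (ψ.toAddMonoidHom.comp (MonoidHom.toAdditiveLeft i).rangeRestrict), fun h =>
    hψ (DFunLike.congr_fun h s)⟩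

end LocallyIndicable

/-- Maps of real sequences that are shifts by `n` for small indices and in which the `j`th
entry of the image is an increasing affine function of the entry `j + n`, with coefficients
depending on the previous entries. -/
def IsTriangular (n : ℤ) (f : Equiv.Perm (ℤ → ℝ)) : Prop :=
  (∃ J, ∀ w : ℤ → ℝ, ∀ j < J, f w j = w (j + n)) ∧
    ∀ (w : ℤ → ℝ) (j : ℤ), ∃ a > 0, ∃ b, ∀ w' : ℤ → ℝ, (∀ i < j + n, w' i = w i) →
      f w' j = a * w' (j + n) + b

namespace IsTriangular

variable {m n : ℤ} {f g : Equiv.Perm (ℤ → ℝ)}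

theorem one : IsTriangular 0 1 :=
  ⟨⟨0, by simp⟩, fun w j => ⟨1, one_pos, 0, by simp⟩⟩

theorem apply_congr (hf : IsTriangular n f) {w w' : ℤ → ℝ} {j : ℤ}
    (h : ∀ i < j + n, w' i = w i) : ∀ i < j, f w' i = f w i := by
  intro i hi
  obtain ⟨a, -, b, hab⟩ := hf.2 w i
  rw [hab w' fun l hl => h l (by lia), hab w fun _ _ => rfl, h _ (by lia)]

theorem mul (hf : IsTriangular m f) (hg : IsTriangular n g) : IsTriangular (m + n) (f * g) := by
  obtain ⟨⟨J, hJ⟩, hf⟩ := hf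
  obtain ⟨⟨K, hK⟩, hg'⟩ := id hg
  refine ⟨⟨min J (K - m), fun w j hj => ?_⟩, fun w j => ?_⟩
  · rw [Equiv.Perm.mul_apply, hJ _ _ (by lia), hK _ _ (by lia), add_assoc]
  · obtain ⟨a, ha, b, hab⟩ := hf (g w) j
    obtain ⟨c, hc, d, hcd⟩ := hg' w (j + m)
    refine ⟨a * c, mul_pos ha hc, a * d + b, fun w' hw => ?_⟩
    rw [← add_assoc] at hw ⊢
    rw [Equiv.Perm.mul_apply, hab _ (hg.apply_congr hw), hcd _ hw, mul_add, mul_assoc, add_assoc j,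
      add_assoc (a * _)]

end IsTriangular

/-- The group of triangular permutations of real sequences, together with their shifts. -/
def triangularGroup : Subgroup (Equiv.Perm (ℤ → ℝ) × Multiplicative ℤ) where
  carrier := {p | IsTriangular p.2.toAdd p.1 ∧ IsTriangular (-p.2.toAdd) p.1⁻¹}
  mul_mem' {p q} hp hq := ⟨hp.1.mul hq.1, by
    simpa [add_comm, toAdd_mul] using hq.2.mul hp.2⟩
  one_mem' := ⟨.one, by simpa using IsTriangular.one⟩
  inv_mem' {p} hp := ⟨hp.2, by simpa using hp.1⟩

theorem IsTriangular.exists_hom {S : Type} [Group S] [Group.FG S] [Nontrivial S]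
    (i : S →* Equiv.Perm (ℤ → ℝ)) (hi : Function.Injective i) (hS : ∀ s, IsTriangular 0 (i s)) :
    ∃ φ : S →* Multiplicative ℝ, φ ≠ 1 := by
  have hbdd : ∃ J, ∀ s, ∀ w, ∀ j < J, i s w j = w j := by
    obtain ⟨T, hT⟩ := Group.FG.out (G := S)
    choose J hJ using fun s => (hS s).1
    obtain ⟨K, hK⟩ := (T.image J).bddBelow
    refine ⟨K, fun s => ?_⟩
    have hs : s ∈ Subgroup.closure (T : Set S) := hT ▸ Subgroup.mem_top s
    induction hs using Subgroup.closure_induction with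
    | mem s hs =>
      intro w j hj
      simpa using hJ s w j (hj.trans_le (hK (by simpa using ⟨s, hs, rfl⟩)))
    | one => simp
    | mul s s' _ _ h h' =>
      intro w j hj
      rw [map_mul, Equiv.Perm.mul_apply, h _ j hj, h' w j hj]
    | inv s _ h =>
      intro w j hj
      have h1 := h (i s⁻¹ w) j hj
      rw [← Equiv.Perm.mul_apply, ← map_mul, mul_inv_cancel, map_one, Equiv.Perm.one_apply] at h1
      exact h1.symm
  obtain ⟨J, hJ⟩ := hbdd
  have hex : ∃ j, ∃ s w, i s w j ≠ w j := by
    obtain ⟨s, hs⟩ := exists_ne (1 : S)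
    by_contra! h
    exact hs (hi (Equiv.ext fun w => funext fun j => by rw [h]; simp))
  obtain ⟨j, ⟨s₀, w₀, hsw⟩, hj⟩ := Int.exists_least_of_bdd (P := fun j => ∃ s w, i s w j ≠ w j)
    ⟨J, fun j ⟨s, w, h⟩ => le_of_not_gt fun hlt => h (hJ s w j hlt)⟩ hex
  have hfix s w l (hl : l < j) : i s w l = w l := by
    by_contra h
    exact (hj l ⟨s, w, h⟩).not_gt hl
  choose a ha b hab using fun s => (hS s).2 w₀ j
  simp only [add_zero] at hab
  have hupd (s y) : i s (Function.update w₀ j y) j = a s * y + b s := by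
    rw [hab s _ fun l hl => Function.update_of_ne hl.ne _ _, Function.update_self]
  have hmul (s s' : S) (y : ℝ) : a (s * s') * y + b (s * s') = a s * (a s' * y + b s') + b s := by
    rw [← hupd, map_mul, Equiv.Perm.mul_apply, hab s, hupd]
    intro l hl
    rw [hfix _ _ _ hl, Function.update_of_ne hl.ne]
  have hamul (s s' : S) : a (s * s') = a s * a s' := by
    linear_combination hmul s s' 1 - hmul s s' 0
  by_cases h1 : ∀ s, a s = 1
  · refine ⟨MonoidHom.mk' (fun s => .ofAdd (b s)) fun s s' => ?_, fun h => hsw ?_⟩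
    · change b (s * s') = b s + b s'
      have := hmul s s' 0
      simp only [h1] at this
      linarith
    · have hb : b s₀ = 0 := DFunLike.congr_fun h s₀
      rw [hab s₀ w₀ fun _ _ => rfl, h1, hb]
      simp
  · refine ⟨MonoidHom.mk' (fun s => .ofAdd (Real.log (a s))) fun s s' => ?_,
      fun h => h1 fun s => ?_⟩
    · rw [hamul, Real.log_mul (ha s).ne' (ha s').ne']
      rfl
    · exact Real.eq_one_of_pos_of_log_eq_zero (ha s) (DFunLike.congr_fun h s)

theorem LocallyIndicable.triangularGroup : LocallyIndicable triangularGroup := by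
  refine LocallyIndicable.int.of_hom ((MonoidHom.snd _ _).comp (Subgroup.subtype _)) ?_
  intro S _ _ _ i hi
  have hsnd s : (i s).1.1.2 = 1 := (i s).2
  obtain ⟨φ, hφ⟩ := IsTriangular.exists_hom (S := S)
    (((MonoidHom.fst _ _).comp _root_.triangularGroup.subtype).comp ((Subgroup.subtype _).comp i))
    (fun s s' h => hi (Subtype.ext (Subtype.ext (Prod.ext h ((hsnd s).trans (hsnd s').symm)))))
    fun s => by
      have := (i s).1.2.1
      rwa [hsnd] at this
  exact LocallyIndicable.real.exists_hom_of_hom hφ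

/-- The entries of `flowFun` at the natural numbers. -/
noncomputable def flowNat (b c : ℝ) (w : ℤ → ℝ) : ℕ → ℝ
  | 0 => w 0 + c
  | n + 1 => w (n + 1) * b ^ (flowNat b c w n - w n)

/-- Translation by `c` of the entry `0`, rescaling the later entries. -/
noncomputable def flowFun (b c : ℝ) (w : ℤ → ℝ) : ℤ → ℝ
  | .ofNat n => flowNat b c w n
  | .negSucc n => w (.negSucc n)

section flow

variable (b c d : ℝ) (w : ℤ → ℝ)

theorem flowFun_zero : flowFun b c w 0 = w 0 + c := rfl

theorem flowFun_succ (n : ℕ) :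
    flowFun b c w (n + 1) = w (n + 1) * b ^ (flowFun b c w n - w n) := rfl

theorem flowFun_of_neg {j : ℤ} (hj : j < 0) : flowFun b c w j = w j := by
  obtain ⟨n, rfl⟩ := Int.eq_negSucc_of_lt_zero hj
  rfl

variable {b}

theorem flowFun_flowFun (hb : 0 < b) : flowFun b c (flowFun b d w) = flowFun b (c + d) w := by
  funext j
  rcases lt_or_ge j 0 with hj | hj
  · simp only [flowFun_of_neg _ _ _ hj]
  lift j to ℕ using hj
  induction j with
  | zero => simp only [Nat.cast_zero, flowFun_zero]; ring
  | succ n ih =>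
    push_cast
    rw [flowFun_succ, ih, flowFun_succ, flowFun_succ, mul_assoc, ← Real.rpow_add hb]
    ring_nf

/-- The one-parameter group translating the entry `0` and rescaling the later entries. -/
noncomputable def flow (hb : 0 < b) : Multiplicative ℝ →* Equiv.Perm (ℤ → ℝ) :=
  MonoidHom.toHomPerm
    { toFun := fun c => flowFun b c.toAdd
      map_one' := by
        funext w j
        change flowFun b 0 w j = w j
        rcases lt_or_ge j 0 with hj | hj
        · exact flowFun_of_neg _ _ _ hj
        lift j to ℕ using hj
        induction j with
        | zero => simp [flowFun_zero]
        | succ n ih =>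
          push_cast
          rw [flowFun_succ, ih]
          simp
      map_mul' := fun c d => funext fun w => (flowFun_flowFun _ _ w hb).symm }

theorem flow_apply (hb : 0 < b) (c : Multiplicative ℝ) : flow hb c w = flowFun b c.toAdd w := rfl

theorem isTriangular_flow (hb : 0 < b) (c : Multiplicative ℝ) : IsTriangular 0 (flow hb c) := by
  have hcongr {w w' : ℤ → ℝ} (n : ℕ) (h : ∀ i < (n + 1 : ℤ), w' i = w i) :
      flowFun b c.toAdd w' n = flowFun b c.toAdd w n := by
    induction n with
    | zero => simp [flowFun_zero, h]
    | succ n ih =>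
      push_cast
      push_cast at h
      rw [flowFun_succ, flowFun_succ, ih fun i hi => h i (by lia), h _ (by lia), h _ (by lia)]
  refine ⟨⟨0, fun w j hj => ?_⟩, fun w j => ?_⟩
  · rw [flow_apply, flowFun_of_neg _ _ _ hj, add_zero]
  simp only [flow_apply, add_zero]
  rcases lt_or_ge j 0 with hj | hj
  · exact ⟨1, one_pos, 0, fun w' _ => by rw [flowFun_of_neg _ _ _ hj]; ring⟩
  lift j to ℕ using hj
  cases j with
  | zero => exact ⟨1, one_pos, c.toAdd, fun w' _ => by simp [flowFun_zero]⟩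
  | succ n =>
    refine ⟨b ^ (flowFun b c.toAdd w n - w n), Real.rpow_pos_of_pos hb _, 0, fun w' h => ?_⟩
    push_cast at h ⊢
    rw [flowFun_succ, hcongr n h, h n (by lia)]
    ring

end flow

/-- The shift of real sequences. -/
def shiftPerm : Equiv.Perm (ℤ → ℝ) := (Equiv.addRight (1 : ℤ)).symm.arrowCongr (Equiv.refl ℝ)

theorem shiftPerm_apply (w : ℤ → ℝ) (j : ℤ) : shiftPerm w j = w (j + 1) := rfl

theorem shiftPerm_inv_apply (w : ℤ → ℝ) (j : ℤ) : shiftPerm⁻¹ w j = w (j - 1) := rfl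

theorem shiftPerm_flow_mul {b : ℝ} (hb : 0 < b) :
    shiftPerm * flow hb (.ofAdd 1) * shiftPerm⁻¹ * flow hb (.ofAdd 1) =
      flow hb (.ofAdd b) * (shiftPerm * flow hb (.ofAdd 1) * shiftPerm⁻¹) := by
  set y := shiftPerm * flow hb (.ofAdd 1) * shiftPerm⁻¹
  have hy (w : ℤ → ℝ) (j : ℤ) : y w j = flowFun b 1 (shiftPerm⁻¹ w) (j + 1) := rfl
  have hneg (w : ℤ → ℝ) {j : ℤ} (hj : j + 1 < 0) : y w j = w j := by
    rw [hy, flowFun_of_neg _ _ _ hj, shiftPerm_inv_apply, add_sub_cancel_right]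
  have hmid (w : ℤ → ℝ) : y w (-1) = w (-1) + 1 := rfl
  have hpos (w : ℤ → ℝ) (n : ℕ) : y w n = w n * b ^ (y w (n - 1) - w (n - 1)) := by
    rw [hy, hy, flowFun_succ, shiftPerm_inv_apply, shiftPerm_inv_apply, sub_add_cancel,
      add_sub_cancel_right]
  refine Equiv.ext fun w => funext fun j => ?_
  change y (flowFun b 1 w) j = flowFun b b (y w) j
  rcases lt_or_ge j 0 with hj | hj
  · rw [flowFun_of_neg _ _ _ hj]
    rcases (Int.add_one_le_iff.2 hj).lt_or_eq with hj' | hj'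
    · rw [hneg _ hj', hneg _ hj', flowFun_of_neg _ _ _ hj]
    · obtain rfl : j = -1 := by lia
      rw [hmid, hmid, flowFun_of_neg _ _ _ hj]
  lift j to ℕ using hj
  rw [hpos]
  induction j with
  | zero =>
    have h := hpos w 0
    simp only [Nat.cast_zero, zero_sub, hmid, flowFun_zero, flowFun_of_neg _ _ _ neg_one_lt_zero,
      add_sub_cancel_left, Real.rpow_one] at h ⊢
    rw [h]
    ring
  | succ n ih =>
    have h := hpos w (n + 1)
    rw [← hpos] at ih
    push_cast at h ⊢
    rw [add_sub_cancel_right] at h ⊢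
    rw [ih, flowFun_succ, flowFun_succ, h, mul_assoc, mul_assoc, ← Real.rpow_add hb,
      ← Real.rpow_add hb]
    ring_nf

theorem exists_locallyIndicable_rhoWord_eq_one (k : ℕ) :
    ∃ (G : Type) (_ : Group G) (x t : G), LocallyIndicable G ∧ rhoWord k x t = 1 ∧
      ∀ N, 0 < N → x ^ N ≠ 1 := by
  have hb : (0 : ℝ) < k + 1 := by positivity
  have hpow (N : ℕ) : flow hb (.ofAdd 1) ^ N = flow hb (.ofAdd N) := by
    rw [← map_pow, ← ofAdd_nsmul, nsmul_one]
  have hx : (flow hb (.ofAdd 1), 1) ∈ triangularGroup :=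
    ⟨isTriangular_flow hb _, by rw [← map_inv]; exact isTriangular_flow hb _⟩
  have ht : (shiftPerm, .ofAdd 1) ∈ triangularGroup :=
    ⟨⟨⟨0, fun w j _ => rfl⟩, fun w j => ⟨1, one_pos, 0, fun w' _ => by
      rw [shiftPerm_apply, toAdd_ofAdd, one_mul, add_zero]⟩⟩,
    ⟨⟨0, fun w j _ => rfl⟩, fun w j => ⟨1, one_pos, 0, fun w' _ => by
      rw [shiftPerm_inv_apply, toAdd_ofAdd]; ring_nf⟩⟩⟩
  refine ⟨triangularGroup, inferInstance, ⟨_, hx⟩, ⟨_, ht⟩, .triangularGroup, ?_, fun N hN h => ?_⟩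
  · have h := shiftPerm_flow_mul hb
    have hk := hpow (k + 1)
    push_cast at hk
    rw [← hk] at h
    exact rhoWord_eq_one_iff.2 (Subtype.ext (Prod.ext h (by simp)))
  · have h1 : flow hb (.ofAdd 1) ^ N = 1 := congrArg (fun f => f.1.1) h
    rw [hpow] at h1
    have h0 : flow hb (.ofAdd N) 0 0 = 0 := by rw [h1]; rfl
    rw [flow_apply, flowFun_zero] at h0
    simp at h0
    lia

/-- Only elements of finite order are conjugate to one of their proper powers. -/
def FinOrderOfConjPow (G : Type) [Group G] : Prop :=
  ∀ (x a : G) (q : ℕ), 2 ≤ q → a * x * a⁻¹ = x ^ q → IsOfFinOrder x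

theorem HNNExtension.finOrderOfConjPow {G : Type} [Group G] [Finite G] {A B : Subgroup G}
    {φ : A ≃* B} : FinOrderOfConjPow (HNNExtension G A B φ) := by
  intro x a q hq hx
  rcases exists_isConj x with ⟨g, hg⟩ | ⟨L, hne, hL, hc⟩
  · exact hg.symm.isOfFinOrder (of.isOfFinOrder (isOfFinOrder_of_finite g))
  · exact absurd hx (conj_ne_pow hL hne hq hc.symm)

theorem FinOrderOfConjPow.coprod {A B : Type} [Group A] [Group B] (hA : FinOrderOfConjPow A)
    (hB : FinOrderOfConjPow B) : FinOrderOfConjPow (Coprod A B) := by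
  intro x a q hq hx
  have map_hx {X : Type} [Group X] (f : Coprod A B →* X) : f a * f x * (f a)⁻¹ = f x ^ q := by
    simpa using congrArg f hx
  obtain ⟨L, rfl⟩ := exists_altEval x
  rcases conjAltLE_altEval L with ⟨c, hc⟩ | ⟨c, hc⟩ | ⟨M, -, hne, hM, hc⟩
  · refine hc.symm.isOfFinOrder ((Coprod.inl (M := A) (N := B)).isOfFinOrder ?_)
    have h1 := Coprod.fst.map_isConj hc
    rw [Coprod.fst_apply_inl] at h1
    exact h1.isOfFinOrder (hA _ _ q hq (map_hx _))
  · refine hc.symm.isOfFinOrder ((Coprod.inr (M := A) (N := B)).isOfFinOrder ?_)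
    have h1 := Coprod.snd.map_isConj hc
    rw [Coprod.snd_apply_inr] at h1
    exact h1.isOfFinOrder (hB _ _ q hq (map_hx _))
  · let ψ : Coprod A B →* EqGroup (A × B) := Coprod.lift (of.comp (MonoidHom.inl A B))
      ((MulAut.conj t).toMonoidHom.comp (of.comp (MonoidHom.inr A B)))
    have h1 := ψ.map_isConj hc
    rw [map_altEval ψ Coprod.inl Coprod.inr M, Coprod.lift_comp_inl, Coprod.lift_comp_inr,
      ← wordEval_altWord] at h1
    exact absurd (map_hx ψ) (conj_ne_pow (isChain_altWord hM) (altWord_ne_nil hne) hq h1.symm)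

/-- The isomorphism between the factors of a direct square. -/
def factorEquiv (M : Type) [Group M] : (MonoidHom.inl M M).range ≃* (MonoidHom.inr M M).range where
  toFun p := ⟨(1, p.1.1), p.1.1, rfl⟩
  invFun p := ⟨(p.1.2, 1), p.1.2, rfl⟩
  left_inv := by
    rintro ⟨-, a, rfl⟩
    rfl
  right_inv := by
    rintro ⟨-, a, rfl⟩
    rfl
  map_mul' p q := Subtype.ext (Prod.ext (one_mul 1).symm rfl)

theorem factorEquiv_inl {M : Type} [Group M] (a : M) :
    factorEquiv M ⟨(a, 1), a, rfl⟩ = ⟨(1, a), a, rfl⟩ := rfl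

/-- The HNN extension of a direct square of a cyclic group of order `k` whose stable letter
conjugates the first factor to the second. -/
abbrev SquareHNN (k : ℕ) : Type :=
  HNNExtension (Multiplicative (ZMod k) × Multiplicative (ZMod k)) _ _
    (factorEquiv (Multiplicative (ZMod k)))

namespace SquareHNN

/-- A generator of the first factor. -/
def gen (k : ℕ) : SquareHNN k := of (.ofAdd 1, 1)

theorem t_mul_of {k : ℕ} (a : Multiplicative (ZMod k)) :
    (t * of (a, 1) : SquareHNN k) = of (1, a) * t := by
  have h := HNNExtension.t_mul_of (φ := factorEquiv (Multiplicative (ZMod k))) ⟨(a, 1), a, rfl⟩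
  rwa [factorEquiv_inl] at h

theorem gen_pow (k : ℕ) : gen k ^ k = 1 := by
  rw [gen, ← map_pow, Prod.pow_mk, ← ofAdd_nsmul]
  simp [← Prod.one_eq_mk]

theorem rhoWord_gen (k : ℕ) : rhoWord k (gen k) t = 1 := by
  rw [rhoWord_eq_one_iff, pow_succ, gen_pow, one_mul, gen, t_mul_of, mul_inv_cancel_right,
    ← map_mul, ← map_mul]
  simp

theorem exists_hom {G : Type} [Group G] {k : ℕ} {x s : G} (h : rhoWord k x s = 1)
    (hx : x ^ k = 1) : ∃ f : SquareHNN k →* G, f (gen k) = x ∧ f t = s := by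
  let p : Multiplicative (ZMod k) →* G := AddMonoidHom.toMultiplicativeLeft
    (ZMod.lift k ⟨zmultiplesHom (Additive G) (.ofMul x), by
      simp [← ofMul_pow, hx]⟩)
  have hp (n : ℤ) : p (.ofAdd (n : ZMod k)) = x ^ n := by
    exact congrArg Additive.toMul (ZMod.lift_coe k _ n)
  have hp1 : p (.ofAdd 1) = x := by simpa using hp 1
  have hsx : Commute x (s * x * s⁻¹) := by
    rw [rhoWord_eq_one_iff, pow_succ, hx, one_mul] at h
    exact h.symm
  have hcomm (a b) : Commute (p a) ((MulAut.conj s).toMonoidHom.comp p b) := by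
    obtain ⟨c, hc⟩ := ZMod.intCast_surjective a.toAdd
    obtain ⟨d, hd⟩ := ZMod.intCast_surjective b.toAdd
    rw [← ofAdd_toAdd a, ← ofAdd_toAdd b, ← hc, ← hd, MonoidHom.comp_apply, hp, hp, map_zpow]
    exact hsx.zpow_zpow c d
  refine ⟨HNNExtension.lift (p.noncommCoprod ((MulAut.conj s).toMonoidHom.comp p) hcomm) s ?_,
    ?_, ?_⟩
  · rintro ⟨-, a, rfl⟩
    have h := factorEquiv_inl a
    simp only [MonoidHom.inl_apply, h]
    simp
  · simp [gen, hp1]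
  · simp

end SquareHNN

end

section

open Monoid

theorem FinOrderOfConjPow.of_injective {G K : Type} [Group G] [Group K] (hK : FinOrderOfConjPow K)
    (f : G →* K) (hf : Function.Injective f) : FinOrderOfConjPow G := fun x a q hq hx =>
  hf.isOfFinOrder_iff.1 (hK (f x) (f a) q hq (by simpa using congrArg f hx))

theorem FinOrderOfConjPow.of_rhoWord {G : Type} [Group G] (hG : FinOrderOfConjPow G) {k : ℕ}
    (hk : k ≠ 0) {x s : G} (h : rhoWord k x s = 1) : IsOfFinOrder x :=
  hG x (s * x * s⁻¹) (k + 1) (by lia) (mul_inv_eq_iff_eq_mul.2 (rhoWord_eq_one_iff.1 h))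

theorem finOrderOfConjPow_presentedGroup (m n : ℕ) [NeZero m] [NeZero n] :
    FinOrderOfConjPow (PresentedGroup ({rhoWord m (FreeGroup.of 0) (FreeGroup.of 1),
      rhoWord n (FreeGroup.of 2) (FreeGroup.of 3), FreeGroup.of 0 ^ m, FreeGroup.of 2 ^ n} :
        Set (FreeGroup (Fin 4)))) := by
  set rels : Set (FreeGroup (Fin 4)) := {rhoWord m (FreeGroup.of 0) (FreeGroup.of 1),
    rhoWord n (FreeGroup.of 2) (FreeGroup.of 3), FreeGroup.of 0 ^ m, FreeGroup.of 2 ^ n}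
  let φ : Fin 4 → Coprod (SquareHNN m) (SquareHNN n) :=
    ![Coprod.inl (SquareHNN.gen m), Coprod.inl HNNExtension.t,
      Coprod.inr (SquareHNN.gen n), Coprod.inr HNNExtension.t]
  have hφ : ∀ r ∈ rels, FreeGroup.lift φ r = 1 := by
    rintro r (rfl | rfl | rfl | rfl)
    · simp [map_rhoWord, φ, ← map_rhoWord (Coprod.inl (N := SquareHNN n)), SquareHNN.rhoWord_gen]
    · simp [map_rhoWord, φ, ← map_rhoWord (Coprod.inr (M := SquareHNN m)), SquareHNN.rhoWord_gen]
    · rw [map_pow]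
      simp [φ, ← map_pow, SquareHNN.gen_pow]
    · rw [map_pow]
      simp [φ, ← map_pow, SquareHNN.gen_pow]
  have hmk {r} (hr : r ∈ rels) : PresentedGroup.mk rels r = 1 := PresentedGroup.one_of_mem hr
  obtain ⟨f, hf0, hf1⟩ := SquareHNN.exists_hom (k := m)
    (x := PresentedGroup.mk rels (FreeGroup.of 0)) (s := PresentedGroup.mk rels (FreeGroup.of 1))
    (by rw [← map_rhoWord]; exact hmk (by simp [rels]))
    (by rw [← map_pow]; exact hmk (by simp [rels]))
  obtain ⟨g, hg0, hg1⟩ := SquareHNN.exists_hom (k := n)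
    (x := PresentedGroup.mk rels (FreeGroup.of 2)) (s := PresentedGroup.mk rels (FreeGroup.of 3))
    (by rw [← map_rhoWord]; exact hmk (by simp [rels]))
    (by rw [← map_pow]; exact hmk (by simp [rels]))
  refine (HNNExtension.finOrderOfConjPow.coprod HNNExtension.finOrderOfConjPow).of_injective
    (PresentedGroup.toGroup hφ)
    (Function.LeftInverse.injective (g := Coprod.lift f g) (DFunLike.congr_fun
      (f := (Coprod.lift f g).comp (PresentedGroup.toGroup hφ)) (g := MonoidHom.id _) ?_))
  ext i
  rw [MonoidHom.comp_apply, PresentedGroup.toGroup.of]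
  fin_cases i <;> simp [φ, *] <;> rfl

theorem exists_not_isOfFinOrder (m n : ℕ) (r : FreeGroup (Fin 4)) :
    ∃ i ∈ ({0, 2} : Set (Fin 4)), ¬ IsOfFinOrder (PresentedGroup.of (rels :=
      {rhoWord m (FreeGroup.of 0) (FreeGroup.of 1), rhoWord n (FreeGroup.of 2) (FreeGroup.of 3),
        r}) i) := by
  obtain ⟨A, _, x, s, hA, hxs, hx⟩ := exists_locallyIndicable_rhoWord_eq_one m
  obtain ⟨B, _, y, u, hB, hyu, hy⟩ := exists_locallyIndicable_rhoWord_eq_one n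
  by_contra! hfin
  set rels : Set (FreeGroup (Fin 4)) := {rhoWord m (FreeGroup.of 0) (FreeGroup.of 1),
    rhoWord n (FreeGroup.of 2) (FreeGroup.of 3), r}
  let φ : Fin 4 → Coprod A B := ![Coprod.inl x, Coprod.inl s, Coprod.inr y, Coprod.inr u]
  have hquot {X : Type} [Group X] (h : Coprod A B →* X) (hr : h (FreeGroup.lift φ r) = 1) :
      IsOfFinOrder (h (Coprod.inl x)) ∧ IsOfFinOrder (h (Coprod.inr y)) := by
    have hφ : ∀ r ∈ rels, FreeGroup.lift (h ∘ φ) r = 1 := by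
      rw [show FreeGroup.lift (h ∘ φ) = h.comp (FreeGroup.lift φ) from
        FreeGroup.ext_hom _ _ (by simp)]
      rintro r (rfl | rfl | rfl)
      · simpa [map_rhoWord, φ] using congrArg (h.comp Coprod.inl) hxs
      · simpa [map_rhoWord, φ] using congrArg (h.comp Coprod.inr) hyu
      · exact hr
    constructor
    · simpa [φ] using (PresentedGroup.toGroup hφ).isOfFinOrder (hfin 0 (by simp))
    · simpa [φ] using (PresentedGroup.toGroup hφ).isOfFinOrder (hfin 2 (by simp))
  have hx' : ¬ IsOfFinOrder x := fun h =>
    let ⟨N, hN, hxN⟩ := isOfFinOrder_iff_pow_eq_one.1 h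
    hx N hN hxN
  have hy' : ¬ IsOfFinOrder y := fun h =>
    let ⟨N, hN, hyN⟩ := isOfFinOrder_iff_pow_eq_one.1 h
    hy N hN hyN
  rcases hA.coprod_dichotomy hB (FreeGroup.lift φ r) with
    ⟨a, ha⟩ | ⟨b, hb⟩ | ⟨X, _, g, f, hg, hf, hX⟩
  · refine hy' ?_
    have h := Coprod.snd.map_isConj ha
    rw [Coprod.snd_apply_inl, isConj_one_left] at h
    simpa using (hquot _ h).2
  · refine hx' ?_
    have h := Coprod.fst.map_isConj hb
    rw [Coprod.fst_apply_inr, isConj_one_left] at h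
    simpa using (hquot _ h).1
  · refine hx' (hg.isOfFinOrder_iff.1 ?_)
    simpa using (hquot _ hX).1

end

/-- Let `m, n ≥ 2` with `gcd(q_m, q_n) = 1`, and let `Γ_{m,n}` be the
presented group `⟨x_m, t_m, x_n, t_n | ρ_m(x_m,t_m), ρ_n(x_n,t_n), x_m^m, x_n^n⟩`.
Then for every element `r` of the free group on `x_m, t_m, x_n, t_n`, the presented
group `⟨x_m, t_m, x_n, t_n | ρ_m(x_m,t_m), ρ_n(x_n,t_n), r⟩` is not isomorphic
to `Γ_{m,n}`. -/
theorem no_three_relator_presentation (m n : ℕ) (hm : 2 ≤ m) (hn : 2 ≤ n)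
    (hq : Nat.gcd (q m) (q n) = 1)
    (xm tm xn tn : FreeGroup (Fin 4))
    (hxm : xm = FreeGroup.of 0) (htm : tm = FreeGroup.of 1)
    (hxn : xn = FreeGroup.of 2) (htn : tn = FreeGroup.of 3)
    (r : FreeGroup (Fin 4)) :
    ¬Nonempty
      (PresentedGroup ({rhoWord m xm tm, rhoWord n xn tn, r} : Set (FreeGroup (Fin 4))) ≃*
        PresentedGroup ({rhoWord m xm tm, rhoWord n xn tn, xm ^ m, xn ^ n} :
          Set (FreeGroup (Fin 4)))) := by
  rintro ⟨e⟩
  subst hxm htm hxn htn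
  have := NeZero.of_pos (zero_lt_two.trans_le hm)
  have := NeZero.of_pos (zero_lt_two.trans_le hn)
  have hΓ := (finOrderOfConjPow_presentedGroup m n).of_injective e.toMonoidHom e.injective
  obtain ⟨i, hi | hi, h⟩ := exists_not_isOfFinOrder m n r
  · subst hi
    refine h (hΓ.of_rhoWord (k := m) (s := PresentedGroup.of 1) (by lia) ?_)
    exact (map_rhoWord (PresentedGroup.mk _) _ _ _).symm.trans (PresentedGroup.one_of_mem (by simp))
  · obtain rfl : i = 2 := hi
    refine h (hΓ.of_rhoWord (k := n) (s := PresentedGroup.of 3) (by lia) ?_)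
    exact (map_rhoWord (PresentedGroup.mk _) _ _ _).symm.trans (PresentedGroup.one_of_mem (by simp))
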